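/- arXiv:2103.09933 — 2 statements merged into one kernel-verified Lean document; each statement's English description precedes it below -/
import Mathlib

section
/- Let p ≥ 5 be a prime, α ≥ 1 an integer, a = p^α, and t an odd positive integer. Set k = ⌈ t(a²−1)/(24a) ⌉, and let b be determined as follows: b = 0 if a = 1; b ≡ (t/3)·8^{−1} (mod a) with 0 ≤ b < a if t ≡ 3 (mod 6); and b ≡ t·24^{−1} (mod a) with 0 ≤ b < a otherwise. Then there exist ε_{d,j} ∈ {0,1}, indexed by divisors d of a and integers 0 ≤ j ≤ ⌊k/d⌋, with ε_{1,0} = 1 and ε_{d,j} = 0 whenever at/d − 24j < 0, such that for every integer n ≥ 0 one has the congruence p_t(an + b) ≡ ∑_{d | a} ∑_{0 ≤ j ≤ ⌊k/d⌋, d | (n + k − dj)} ε_{d,j} · p_{at/d − 24j}((n + k − dj)/d) (mod 2), where the summand is omitted when d does not divide n + k − dj; equivalently, q^k ∑_{n≥0} p_t(an+b) q^n ≡ ∑_{d|a} ∑_{j=0}^{⌊k/d⌋} ε_{d,j} q^{dj} / ∏_{i≥1}(1 − q^{di})^{at/d − 24j} (mod 2) as formal power series. -/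
/-- Number of `t`-tuples of partitions with total size `n`, i.e. the
`t`-multipartition function `p_t(n)` (with `p_0(0) = 1`, `p_0(n) = 0` for `n ≥ 1`). -/
def multipartition (t n : ℕ) : ℕ :=
  ∑ v ∈ Finset.Nat.antidiagonalTuple t n, ∏ i, Fintype.card (Nat.Partition (v i))

open PowerSeries in
/-- The formal power series `A` converges on the open unit disc with sum `F`. -/
def SeriesOnDisc (A : PowerSeries ℂ) (F : ℂ → ℂ) : Prop :=
  ∀ q : ℂ, ‖q‖ < 1 → HasSum (fun n ↦ A.coeff n * q ^ n) (F q)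

namespace SeriesOnDisc

open PowerSeries Metric

variable {A B : PowerSeries ℂ} {F G : ℂ → ℂ}

lemma mul (hA : SeriesOnDisc A F) (hB : SeriesOnDisc B G) :
    SeriesOnDisc (A * B) (fun q ↦ F q * G q) := by
  intro q hq
  have h1 := (hA q hq).summable.norm
  have h2 := (hB q hq).summable.norm
  have hs := summable_norm_sum_mul_antidiagonal_of_summable_norm h1 h2
  have ht := tsum_mul_tsum_eq_tsum_sum_antidiagonal_of_summable_norm h1 h2
  rw [(hA q hq).tsum_eq, (hB q hq).tsum_eq] at ht
  have := hs.of_norm.hasSum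
  rw [← ht] at this
  have hfun : (fun n ↦ (A * B).coeff n * q ^ n) = fun n ↦ ∑ kl ∈ Finset.HasAntidiagonal.antidiagonal n,
      A.coeff kl.1 * q ^ kl.1 * (B.coeff kl.2 * q ^ kl.2) := ?_
  · rw [hfun]
    exact this
  funext n
  rw [coeff_mul, Finset.sum_mul]
  refine Finset.sum_congr rfl fun x hx ↦ ?_
  rw [← Finset.HasAntidiagonal.mem_antidiagonal.mp hx, pow_add]
  ring

lemma one : SeriesOnDisc 1 (fun _ ↦ 1) := by
  intro q _
  convert hasSum_ite_eq (0 : ℕ) (1 : ℂ) using 2 with n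
  by_cases h : n = 0 <;> simp [coeff_one, h]

lemma pow (hA : SeriesOnDisc A F) (n : ℕ) : SeriesOnDisc (A ^ n) (fun q ↦ F q ^ n) := by
  induction n with
  | zero => simpa using one
  | succ n ih => simpa [pow_succ] using ih.mul hA

lemma add (hA : SeriesOnDisc A F) (hB : SeriesOnDisc B G) :
    SeriesOnDisc (A + B) (fun q ↦ F q + G q) := by
  intro q hq
  simpa [add_mul] using (hA q hq).add (hB q hq)

lemma expand (hA : SeriesOnDisc A F) {p : ℕ} (hp : p ≠ 0) :
    SeriesOnDisc (PowerSeries.expand p hp A) (fun q ↦ F (q ^ p)) := by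
  intro q hq
  have hq' : ‖q ^ p‖ < 1 := by
    rw [norm_pow]
    exact pow_lt_one₀ (norm_nonneg _) hq hp
  have hinj : Function.Injective (fun n : ℕ ↦ p * n) := fun a b h ↦
    Nat.eq_of_mul_eq_mul_left (Nat.pos_of_ne_zero hp) h
  rw [← hinj.hasSum_iff]
  · convert hA _ hq' using 2 with n
    simp [pow_mul, coeff_expand_mul]
  · intro n hn
    rw [coeff_expand_of_not_dvd, zero_mul]
    rintro ⟨m, rfl⟩
    exact hn ⟨m, rfl⟩

lemma hasFPowerSeriesOnBall (hA : SeriesOnDisc A F) :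
    HasFPowerSeriesOnBall F (.ofScalars ℂ fun n ↦ A.coeff n) 0 1 := by
  constructor
  · refine le_of_forall_lt_imp_le_of_dense fun r hr ↦ ?_
    lift r to NNReal using hr.ne_top
    apply FormalMultilinearSeries.le_radius_of_summable
    simpa [smul_eq_mul, norm_mul, mul_comm, mul_left_comm, mul_assoc] using
      (hA (r : ℂ) (by simpa using hr)).summable.norm
  · simp
  · intro y hy
    rw [← ENNReal.coe_one, Metric.eball_coe, NNReal.coe_one, mem_ball_zero_iff] at hy
    simpa [mul_comm] using hA y hy

lemma unique (hA : SeriesOnDisc A F) (hB : SeriesOnDisc B F) : A = B := by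
  have h := hA.hasFPowerSeriesOnBall.hasFPowerSeriesAt.eq_formalMultilinearSeries
    hB.hasFPowerSeriesOnBall.hasFPowerSeriesAt
  ext n
  have := congrArg (fun s ↦ s.coeff n) h
  simpa [FormalMultilinearSeries.coeff_ofScalars] using this

lemma of_differentiableOn (hF : DifferentiableOn ℂ F (ball 0 1)) :
    SeriesOnDisc (PowerSeries.mk fun n ↦ (n.factorial : ℂ)⁻¹ * iteratedDeriv n F 0) F := by
  intro q hq
  have h := Complex.hasSum_taylorSeries_on_ball hF (z := q) (by simpa using hq)
  simpa [mul_assoc, mul_comm, mul_left_comm] using h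

lemma congr (hA : SeriesOnDisc A F) (h : ∀ q, ‖q‖ < 1 → F q = G q) : SeriesOnDisc A G := by
  intro q hq
  rw [← h q hq]
  exact hA q hq

lemma of_polynomial (p : Polynomial ℂ) : SeriesOnDisc (p : PowerSeries ℂ) (fun q ↦ p.eval q) := by
  intro q _
  have : HasSum (fun n ↦ p.coeff n * q ^ n) (∑ n ∈ p.support, p.coeff n * q ^ n) :=
    hasSum_sum_of_ne_finset_zero fun n hn ↦ by simp [Polynomial.notMem_support_iff.mp hn]
  simpa [Polynomial.eval_eq_sum, Polynomial.sum] using this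

end SeriesOnDisc

lemma TendstoLocallyUniformlyOn.iteratedDeriv {ι : Type*} {l : Filter ι} {U : Set ℂ}
    {F : ι → ℂ → ℂ} {f : ℂ → ℂ} (hf : TendstoLocallyUniformlyOn F f l U)
    (hF : ∀ i, DifferentiableOn ℂ (F i) U) (hU : IsOpen U) (n : ℕ) :
    TendstoLocallyUniformlyOn (fun i ↦ iteratedDeriv n (F i)) (iteratedDeriv n f) l U ∧
      ∀ i, DifferentiableOn ℂ (_root_.iteratedDeriv n (F i)) U := by
  induction n with
  | zero => simpa using ⟨hf, hF⟩
  | succ n ih =>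
    simp only [iteratedDeriv_succ]
    exact ⟨ih.1.deriv (.of_forall ih.2) hU, fun i ↦ (ih.2 i).deriv hU⟩

section

open PowerSeries Metric

/-- The Euler product `∏ (1 - q ^ (n + 1))`. -/
noncomputable def eulerPhi (q : ℂ) : ℂ := ∏' n : ℕ, (1 - q ^ (n + 1))

lemma seriesOnDisc_eulerPhi : SeriesOnDisc (pentagonalSeries ℂ) eulerPhi := by
  have hd : DifferentiableOn ℂ eulerPhi (ball 0 1) := ModularForm.differentiableOn_tprod_one_sub_pow
  have h0 := SeriesOnDisc.of_differentiableOn hd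
  suffices h : (PowerSeries.mk fun n ↦ (n.factorial : ℂ)⁻¹ * iteratedDeriv n eulerPhi 0) =
      pentagonalSeries ℂ by rwa [h] at h0
  ext n
  set P : Finset ℕ → Polynomial ℂ := fun s ↦ ∏ n ∈ s, (1 - Polynomial.X ^ (n + 1)) with hP
  have hPd : ∀ s, DifferentiableOn ℂ (fun q ↦ (P s).eval q) (ball 0 1) := fun s ↦
    (P s).differentiable.differentiableOn
  have hlim : TendstoLocallyUniformlyOn (fun s q ↦ (P s).eval q) eulerPhi Filter.atTop
      (ball 0 1) := by
    have := ModularForm.multipliableLocallyUniformlyOn_one_sub_pow.hasProdLocallyUniformlyOn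
    have h2 : TendstoLocallyUniformlyOn _ _ _ _ := this
    convert h2 using 3 with s q
    · simp [hP, Polynomial.eval_prod]
    · rfl
  have hlim' := ((hlim.iteratedDeriv hPd isOpen_ball n).1.tendsto_at
    (a := 0) (by simp)).const_mul ((n.factorial : ℂ)⁻¹)
  have hev : ∀ s, (n.factorial : ℂ)⁻¹ * iteratedDeriv n (fun q ↦ (P s).eval q) 0 =
      (∏ n ∈ s, (1 - X ^ (n + 1)) : PowerSeries ℂ).coeff n := by
    intro s
    have := (SeriesOnDisc.of_differentiableOn (hPd s)).unique (SeriesOnDisc.of_polynomial (P s))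
    have h2 := congrArg (fun A ↦ A.coeff n) this
    simp only [coeff_mk] at h2
    rw [h2]
    congr 1
    rw [← Polynomial.coeToPowerSeries.ringHom_apply, map_prod]
    simp
  simp only [hev] at hlim'
  rw [coeff_mk]
  refine tendsto_nhds_unique hlim' ?_
  refine tendsto_const_nhds.congr' ?_
  filter_upwards [coeff_prod_one_sub_X_pow_eventually_eq ℂ n] with s hs using hs.symm

lemma eulerPhi_ne_zero {q : ℂ} (hq : ‖q‖ < 1) : eulerPhi q ≠ 0 := by
  unfold eulerPhi
  simp only [sub_eq_add_neg]
  refine tprod_one_add_ne_zero_of_summable (f := fun n ↦ -q ^ (n + 1)) ?_ ?_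
  · intro i h
    have h1 : q ^ (i + 1) = 1 := by linear_combination -h
    have := congrArg norm h1
    rw [norm_pow, norm_one] at this
    exact absurd this (pow_lt_one₀ (norm_nonneg _) hq (by omega)).ne
  · simpa using (summable_nat_add_iff 1).mpr (summable_geometric_of_lt_one (norm_nonneg _) hq)

/-- The generating function of the number of partitions. -/
noncomputable def partitionSeries : PowerSeries ℤ :=
  PowerSeries.mk fun n ↦ (Fintype.card (Nat.Partition n) : ℤ)

open Nat.Partition PowerSeries.WithPiTopology in
lemma partitionSeries_mul_pentagonalSeries :
    partitionSeries * pentagonalSeries ℤ = 1 := by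
  let _ : TopologicalSpace ℤ := ⊥
  have : DiscreteTopology ℤ := ⟨rfl⟩
  have h1 := hasProd_powerSeriesMk_card_restricted ℤ (fun _ ↦ True)
  have h2 := hasProd_one_sub_X_pow ℤ
  have h3 := h1.mul h2
  have h4 : (PowerSeries.mk fun n ↦ ((restricted n (fun _ ↦ True)).card : ℤ)) = partitionSeries := by
    ext n
    simp [partitionSeries, restricted, Finset.card_univ]
  rw [h4] at h3
  refine h3.unique ?_
  have hfun : (fun i : ℕ ↦ (if True then ∑' j : ℕ, (X : PowerSeries ℤ) ^ ((i + 1) * j) else 1) *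
      (1 - X ^ (i + 1))) = fun _ ↦ 1 := by
    funext i
    rw [if_pos trivial]
    simp only [pow_mul]
    exact tsum_pow_mul_one_sub_of_constantCoeff_eq_zero (by simp)
  rw [hfun]
  exact hasProd_one

lemma seriesOnDisc_partitionSeries :
    SeriesOnDisc (partitionSeries.map (Int.castRingHom ℂ)) (fun q ↦ (eulerPhi q)⁻¹) := by
  have hd : DifferentiableOn ℂ eulerPhi (ball 0 1) := ModularForm.differentiableOn_tprod_one_sub_pow
  have hd' : DifferentiableOn ℂ (fun q ↦ (eulerPhi q)⁻¹) (ball 0 1) :=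
    hd.inv fun q hq ↦ eulerPhi_ne_zero (by simpa using hq)
  have h0 := SeriesOnDisc.of_differentiableOn hd'
  set B := (PowerSeries.mk fun n ↦ (n.factorial : ℂ)⁻¹ *
    iteratedDeriv n (fun q ↦ (eulerPhi q)⁻¹) 0) with hB
  have h1 : B * pentagonalSeries ℂ = 1 := by
    refine (h0.mul seriesOnDisc_eulerPhi).unique (SeriesOnDisc.one.congr fun q hq ↦ ?_)
    rw [inv_mul_cancel₀ (eulerPhi_ne_zero hq)]
  have h2 : partitionSeries.map (Int.castRingHom ℂ) * pentagonalSeries ℂ = 1 := by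
    have := congrArg (PowerSeries.map (Int.castRingHom ℂ)) partitionSeries_mul_pentagonalSeries
    rw [map_mul, map_one] at this
    convert this using 2
    ext n
    simp only [coeff_map, pentagonalSeries, coeff_mk]
    split_ifs <;> simp
  have h3 : B = partitionSeries.map (Int.castRingHom ℂ) := by
    calc B = B * (partitionSeries.map (Int.castRingHom ℂ) * pentagonalSeries ℂ) := by
          rw [h2, mul_one]
      _ = partitionSeries.map (Int.castRingHom ℂ) * (B * pentagonalSeries ℂ) := by ring
      _ = _ := by rw [h1, mul_one]
  rwa [← h3]

lemma map_pentagonalSeries {R : Type*} [CommRing R] :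
    (pentagonalSeries ℤ).map (Int.castRingHom R) = pentagonalSeries R := by
  ext n
  simp only [coeff_map, pentagonalSeries, coeff_mk]
  split_ifs <;> simp

end

open PowerSeries in
lemma coeff_partitionSeries_pow (t n : ℕ) :
    (partitionSeries ^ t).coeff n = multipartition t n := by
  have h : partitionSeries ^ t = ∏ _i : Fin t, partitionSeries := by simp
  rw [h, coeff_prod, multipartition]
  push_cast
  refine Finset.sum_bij' (fun l _ ↦ fun i ↦ l i) (fun v _ ↦ Finsupp.equivFunOnFinite.symm v)
    ?_ ?_ ?_ ?_ ?_
  · intro l hl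
    rw [Finset.mem_finsuppAntidiag] at hl
    exact Finset.Nat.mem_antidiagonalTuple.mpr hl.1
  · intro v hv
    rw [Finset.mem_finsuppAntidiag]
    exact ⟨by simpa using Finset.Nat.mem_antidiagonalTuple.mp hv, by simp⟩
  · intro l _
    ext; simp
  · intro v _
    ext; simp
  · intro l _
    simp [partitionSeries]

section

open UpperHalfPlane ModularForm MatrixGroups EisensteinSeries PowerSeries

/-- The integral `q`-expansion of the Eisenstein series of weight `4`. -/
noncomputable def eisensteinFourSeries : PowerSeries ℤ :=
  1 + 240 * PowerSeries.mk fun n ↦ (ArithmeticFunction.sigma 3 n : ℤ)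

/-- The integral `q`-expansion of the modular discriminant. -/
noncomputable def discriminantSeries : PowerSeries ℤ := X * pentagonalSeries ℤ ^ 24

lemma qExpansion_eisensteinFour :
    qExpansion 1 E₄ = eisensteinFourSeries.map (Int.castRingHom ℂ) := by
  ext n
  rw [E_qExpansion_coeff _ ⟨2, rfl⟩]
  have h240 : (240 : PowerSeries ℤ) = PowerSeries.C 240 := by simp
  have hb : bernoulli 4 = -1 / 30 := by decide +kernel
  rw [eisensteinFourSeries, h240, coeff_map, map_add, coeff_C_mul, coeff_one, coeff_mk]
  rcases eq_or_ne n 0 with rfl | hn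
  · simp
  · norm_num [hn, hb]

lemma qExpansion_discriminant :
    qExpansion 1 CuspForm.discriminant = discriminantSeries.map (Int.castRingHom ℂ) := by
  have hX : SeriesOnDisc (X : PowerSeries ℂ) (fun q ↦ q) := by
    simpa using SeriesOnDisc.of_polynomial Polynomial.X
  have h := hX.mul (seriesOnDisc_eulerPhi.pow 24)
  have h2 : (X * pentagonalSeries ℂ ^ 24 : PowerSeries ℂ) =
      discriminantSeries.map (Int.castRingHom ℂ) := by
    simp [discriminantSeries, map_pentagonalSeries]
  rw [h2] at h
  suffices hs : ∀ τ : ℍ, HasSum (fun n ↦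
      (discriminantSeries.map (Int.castRingHom ℂ)).coeff n • Function.Periodic.qParam 1 (τ : ℂ) ^ n)
      (CuspForm.discriminant τ) by
    ext n
    exact (ModularFormClass.qExpansion_coeff_unique one_pos one_mem_strictPeriods_SL hs n).symm
  intro τ
  have hq : ‖Function.Periodic.qParam 1 (τ : ℂ)‖ < 1 := by
    exact_mod_cast norm_qParam_lt_one 1 τ
  have h3 := h _ hq
  have h4 : CuspForm.discriminant τ = Function.Periodic.qParam 1 (τ : ℂ) *
      eulerPhi (Function.Periodic.qParam 1 (τ : ℂ)) ^ 24 := by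
    rw [CuspForm.coe_discriminant, discriminant_eq_q_prod,
      (multipliableLocallyUniformlyOn_eta.multipliable τ.2).tprod_pow]
    rfl
  rw [h4]
  simpa [smul_eq_mul] using h3

lemma partitionSeries_pow_mul_pentagonalSeries_pow (n : ℕ) :
    partitionSeries ^ n * pentagonalSeries ℤ ^ n = 1 := by
  rw [← mul_pow, partitionSeries_mul_pentagonalSeries, one_pow]

/-- A modular form of level one and weight `4 * m` with integral `q`-expansion is an integral
combination of the forms `E₄ ^ (m - 3 * j) * Δ ^ j`. -/
lemma exists_integral_combination (m : ℕ) (f : ModularForm 𝒮ℒ ((4 * m : ℕ) : ℤ))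
    (B : PowerSeries ℤ) (hf : qExpansion 1 f = B.map (Int.castRingHom ℂ)) :
    ∃ c : ℕ → ℤ, B = ∑ j ∈ Finset.range (m / 3 + 1),
      PowerSeries.C (c j) * (eisensteinFourSeries ^ (m - 3 * j) * discriminantSeries ^ j) := by
  induction m using Nat.strong_induction_on generalizing B with
  | _ m ih =>
  set c₀ : ℤ := B.coeff 0 with hc₀
  set F : ModularForm 𝒮ℒ ((4 * m : ℕ) : ℤ) :=
    ModularForm.mcast (by push_cast; ring) (E₄.pow m) rfl with hF
  have hqF : qExpansion 1 F = (eisensteinFourSeries ^ m).map (Int.castRingHom ℂ) := by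
    rw [hF, ModularForm.qExpansion_mcast,
      ModularForm.qExpansion_pow one_pos one_mem_strictPeriods_SL, qExpansion_eisensteinFour,
      map_pow]
  set g : ModularForm 𝒮ℒ ((4 * m : ℕ) : ℤ) := f - (c₀ : ℂ) • F with hg
  set B' : PowerSeries ℤ := B - PowerSeries.C c₀ * eisensteinFourSeries ^ m with hB'
  have hqg : qExpansion 1 g = B'.map (Int.castRingHom ℂ) := by
    have h1 := ModularForm.qExpansion_sub one_pos one_mem_strictPeriods_SL f ((c₀ : ℂ) • F)
    have h2 := ModularForm.qExpansion_smul one_pos one_mem_strictPeriods_SL (c₀ : ℂ) F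
    rw [hg, FunLike.coe_sub, h1, FunLike.coe_smul, h2, hf, hqF, hB', map_sub, map_mul, map_C,
      PowerSeries.smul_eq_C_mul]
    simp
  have hE0 : eisensteinFourSeries.coeff 0 = 1 := by simp [eisensteinFourSeries]
  have hB0 : B'.coeff 0 = 0 := by
    rw [coeff_zero_eq_constantCoeff] at hE0
    simp [hB', hc₀, hE0]
  have hg0 : (qExpansion 1 g).coeff 0 = 0 := by rw [hqg, coeff_map, hB0, map_zero]
  have hdiv := ModularForm.qExpansion_eq_qExpansion_discriminant_mul g hg0
  set h := CuspForm.discriminantEquiv (toCuspForm g hg0) with hh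
  have hB : B = PowerSeries.C c₀ * eisensteinFourSeries ^ m + B' := by rw [hB']; ring
  by_cases hm : m < 3
  · have h0 : (h : ℍ → ℂ) = 0 := ModularFormClass.levelOne_neg_weight_eq_zero (by omega) h
    rw [h0, qExpansion_zero, mul_zero, hqg] at hdiv
    have hB'0 : B' = 0 := by
      ext n
      have := congrArg (fun A ↦ A.coeff n) hdiv
      simpa using this
    refine ⟨fun _ ↦ c₀, ?_⟩
    rw [Nat.div_eq_of_lt hm, hB, hB'0]
    simp
  · obtain ⟨m, rfl⟩ : ∃ m', m = m' + 3 := ⟨m - 3, by omega⟩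
    obtain ⟨B'', hB''⟩ : X ∣ B' := X_dvd_iff.mpr (by simpa using hB0)
    set H := B'' * partitionSeries ^ 24 with hH
    have hBH : B' = discriminantSeries * H := by
      rw [hB'', hH, discriminantSeries]
      linear_combination (-(X * B'')) * partitionSeries_pow_mul_pentagonalSeries_pow 24
    have hne : discriminantSeries.map (Int.castRingHom ℂ) ≠ 0 := by
      intro h0
      have h1 := congrArg (fun A ↦ A * partitionSeries.map (Int.castRingHom ℂ) ^ 24) h0
      have h2 := congrArg (PowerSeries.map (Int.castRingHom ℂ))
        (partitionSeries_pow_mul_pentagonalSeries_pow 24)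
      simp only [discriminantSeries, map_mul, map_pow, zero_mul, map_one, map_X] at h1 h2
      rw [mul_assoc, mul_comm (_ ^ 24), h2, mul_one] at h1
      exact X_ne_zero h1
    have hqh : qExpansion 1 h = H.map (Int.castRingHom ℂ) := by
      rw [hqg, hBH, map_mul] at hdiv
      have hD := qExpansion_discriminant
      rw [CuspForm.coe_discriminant] at hD
      rw [hD] at hdiv
      exact (mul_left_cancel₀ hne hdiv).symm
    obtain ⟨c, hc⟩ := ih m (by omega) (ModularForm.mcast (by push_cast; ring) h rfl) H
      (by rw [ModularForm.qExpansion_mcast, hqh])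
    refine ⟨fun j ↦ if j = 0 then c₀ else c (j - 1), ?_⟩
    rw [hB, hBH, hc, Nat.add_div_right m (by norm_num), add_comm,
      Finset.mul_sum, Finset.sum_range_succ' _ (m / 3 + 1)]
    congr 1
    · refine Finset.sum_congr rfl fun j _ ↦ ?_
      rw [show m + 3 - 3 * (j + 1) = m - 3 * j by omega]
      simp only [Nat.add_eq_zero_iff, one_ne_zero, and_false, ↓reduceIte, Nat.add_sub_cancel]
      ring
    · simp

end

section

open UpperHalfPlane hiding I
open ModularForm MatrixGroups Complex

lemma stdAddChar_three_one_eq : ZMod.stdAddChar (1 : ZMod 3) = cexp (2 * Real.pi * I / 3) := by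
  have := ZMod.stdAddChar_coe (N := 3) 1
  simpa using this

lemma eta_add_one_pow_eight (z : ℂ) :
    η (z + 1) ^ 8 = ZMod.stdAddChar (1 : ZMod 3) * η z ^ 8 := by
  have h1 : ∀ n, eta_q n (z + 1) = eta_q n z := by
    intro n
    rw [eta_q_eq_pow, eta_q_eq_pow, mul_add, Complex.exp_add, mul_one, Complex.exp_two_pi_mul_I,
      mul_one]
  rw [stdAddChar_three_one_eq]
  simp only [ModularForm.eta, h1, mul_pow, Function.Periodic.qParam, ← Complex.exp_nat_mul]
  rw [← mul_assoc, ← Complex.exp_add]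
  congr 2
  push_cast
  ring

lemma eta_neg_one_div_pow_eight (z : ℍ) : η (-1 / (z : ℂ)) ^ 8 = (z : ℂ) ^ 4 * η z ^ 8 := by
  have h := eta_comp_eq_csqrt_I_inv z.2
  have hs : ∀ w : ℂ, w ≠ 0 → (Complex.sqrt w) ^ 8 = w ^ 4 := by
    intro w hw
    rw [sqrt_eq_exp hw, ← Complex.exp_nat_mul]
    rw [show ((8 : ℕ) : ℂ) * (log w / 2) = ((4 : ℕ) : ℂ) * log w by push_cast; ring,
      Complex.exp_nat_mul, exp_log hw]
  simp only [Function.comp_apply] at h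
  rw [h]
  simp only [Pi.smul_apply, Pi.mul_apply, smul_eq_mul, mul_pow, inv_pow]
  rw [hs _ z.ne_zero, hs _ I_ne_zero]
  simp

/-- The exponent of the cubic character by which `η ^ 8` transforms under `SL(2, ℤ)`. -/
def etaExponent (γ : SL(2, ℤ)) : ZMod 3 :=
  ((γ 0 0 : ZMod 3) + γ 1 1) * γ 1 0 - γ 0 1 * γ 1 1 * ((γ 1 0 : ZMod 3) ^ 2 - 1)

lemma etaExponent_S_mul (γ : SL(2, ℤ)) : etaExponent (ModularGroup.S * γ) = etaExponent γ := by
  have hdet : (γ 0 0 : ZMod 3) * γ 1 1 - γ 0 1 * γ 1 0 = 1 := by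
    have := γ.det_coe
    rw [Matrix.det_fin_two] at this
    exact_mod_cast congrArg (Int.cast : ℤ → ZMod 3) this
  have key : ∀ a b c d : ZMod 3, a * d - b * c = 1 →
      (-c + b) * a - -d * b * (a ^ 2 - 1) = (a + d) * c - b * d * (c ^ 2 - 1) := by decide
  have := key _ _ _ _ hdet
  simpa [etaExponent, Matrix.SpecialLinearGroup.coe_mul, ModularGroup.coe_S, Matrix.mul_apply,
    Fin.sum_univ_two] using this

lemma etaExponent_T_mul (γ : SL(2, ℤ)) : etaExponent (ModularGroup.T * γ) = 1 + etaExponent γ := by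
  have hdet : (γ 0 0 : ZMod 3) * γ 1 1 - γ 0 1 * γ 1 0 = 1 := by
    have := γ.det_coe
    rw [Matrix.det_fin_two] at this
    exact_mod_cast congrArg (Int.cast : ℤ → ZMod 3) this
  have key : ∀ a b c d : ZMod 3, a * d - b * c = 1 →
      (a + c + d) * c - (b + d) * d * (c ^ 2 - 1) = 1 + ((a + d) * c - b * d * (c ^ 2 - 1)) := by
    decide
  have := key _ _ _ _ hdet
  simpa [etaExponent, Matrix.SpecialLinearGroup.coe_mul, ModularGroup.coe_T, Matrix.mul_apply,
    Fin.sum_univ_two] using this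

lemma etaExponent_one : etaExponent 1 = 0 := by
  simp [etaExponent]

lemma eta_smul_pow_eight (γ : SL(2, ℤ)) : ∀ z : ℍ, η (γ • z : ℍ) ^ 8 =
    ZMod.stdAddChar (etaExponent γ) * denom γ z ^ 4 * η z ^ 8 := by
  set P : SL(2, ℤ) → Prop := fun γ ↦ ∀ z : ℍ, η (γ • z : ℍ) ^ 8 =
    ZMod.stdAddChar (etaExponent γ) * denom γ z ^ 4 * η z ^ 8 with hP
  have hS : ∀ γ, P (ModularGroup.S * γ) ↔ P γ := by
    intro γ
    refine forall_congr' fun z ↦ ?_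
    have h1 : η ((ModularGroup.S * γ) • z : ℍ) ^ 8 = ((γ • z : ℍ) : ℂ) ^ 4 * η (γ • z : ℍ) ^ 8 := by
      rw [mul_smul, ← eta_neg_one_div_pow_eight, modular_S_smul]
      simp [neg_div]
    have h2 : denom (ModularGroup.S * γ : SL(2, ℤ)) z = ((γ • z : ℍ) : ℂ) * denom γ z := by
      have h := UpperHalfPlane.denom_ne_zero (γ : GL (Fin 2) ℝ) z
      rw [ModularGroup.sl_moeb, coe_smul_of_det_pos (by simp), div_mul_cancel₀ _ h,
        ModularGroup.denom_apply]
      simp [num, Matrix.SpecialLinearGroup.coe_mul, ModularGroup.coe_S, Matrix.mul_apply,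
        Fin.sum_univ_two]
    rw [h1, etaExponent_S_mul, h2]
    have h3 := pow_ne_zero 4 (γ • z : ℍ).ne_zero
    constructor
    · intro h
      apply mul_left_cancel₀ h3
      rw [h]; ring
    · intro h
      rw [h]; ring
  have hT : ∀ γ, P (ModularGroup.T * γ) ↔ P γ := by
    intro γ
    refine forall_congr' fun z ↦ ?_
    have h1 : η ((ModularGroup.T * γ) • z : ℍ) ^ 8 =
        ZMod.stdAddChar (1 : ZMod 3) * η (γ • z : ℍ) ^ 8 := by
      rw [mul_smul, ← eta_add_one_pow_eight, modular_T_smul]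
      simp [add_comm]
    have h2 : denom (ModularGroup.T * γ : SL(2, ℤ)) z = denom γ z := by
      rw [ModularGroup.denom_apply, ModularGroup.denom_apply]
      simp
    rw [h1, etaExponent_T_mul, h2, AddChar.map_add_eq_mul]
    have h3 : ZMod.stdAddChar (1 : ZMod 3) ≠ 0 := by
      rw [stdAddChar_three_one_eq]; exact Complex.exp_ne_zero _
    constructor
    · intro h
      apply mul_left_cancel₀ h3
      rw [h]; ring
    · intro h
      rw [h]; ring
  have hmem : γ ∈ Subgroup.closure {ModularGroup.S, ModularGroup.T} := by
    rw [SpecialLinearGroup.SL2Z_generators]; trivial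
  change P γ
  induction hmem using Subgroup.closure_induction_left with
  | one => intro z; simp [etaExponent_one]
  | mul_left x hx y _ ih =>
    rcases hx with rfl | rfl
    · exact (hS y).mpr ih
    · exact (hT y).mpr ih
  | inv_mul_cancel x hx y _ ih =>
    rcases hx with rfl | rfl
    · exact (hS _).mp (by rwa [mul_inv_cancel_left])
    · exact (hT _).mp (by rwa [mul_inv_cancel_left])

lemma eta_pow_eight_of_moebius {a b c d : ℤ} (hdet : a * d - b * c = 1)
    (he : ((a : ZMod 3) + d) * c - b * d * ((c : ZMod 3) ^ 2 - 1) = 0) {z w : ℂ} (hz : 0 < z.im)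
    (hw : w * (c * z + d) = a * z + b) : η w ^ 8 = (c * z + d) ^ 4 * η z ^ 8 := by
  set γ : SL(2, ℤ) := ⟨!![a, b; c, d], by rw [Matrix.det_fin_two]; simpa using hdet⟩ with hγ
  have h := eta_smul_pow_eight γ ⟨z, hz⟩
  have h0 : etaExponent γ = 0 := by simpa [etaExponent, hγ] using he
  have hd : denom (γ : GL (Fin 2) ℝ) z = c * z + d := by
    have := ModularGroup.denom_apply γ ⟨z, hz⟩
    simpa [hγ] using this
  have hne : denom (γ : GL (Fin 2) ℝ) z ≠ 0 := UpperHalfPlane.denom_ne_zero _ ⟨z, hz⟩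
  have hsm : ((γ • (⟨z, hz⟩ : ℍ) : ℍ) : ℂ) = w := by
    rw [ModularGroup.sl_moeb, coe_smul_of_det_pos (by simp)]
    rw [div_eq_iff hne]
    change _ = w * denom _ z
    rw [hd, hw]
    have : num (γ : GL (Fin 2) ℝ) z = ((γ 0 0 : ℤ) : ℂ) * z + ((γ 0 1 : ℤ) : ℂ) := by simp [num]
    rw [this]
    simp [hγ]
  rw [h0, hsm] at h
  rw [h, AddChar.map_zero_eq_one, one_mul]
  change denom _ z ^ 4 * _ = _
  rw [hd]

/-- The function `η⁻⁸ᵗ`. -/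
noncomputable def etaInv (t : ℕ) (z : ℂ) : ℂ := ((η z ^ 8)⁻¹) ^ t

lemma etaInv_of_moebius (t : ℕ) {a b c d : ℤ} (hdet : a * d - b * c = 1)
    (he : ((a : ZMod 3) + d) * c - b * d * ((c : ZMod 3) ^ 2 - 1) = 0) {z w : ℂ} (hz : 0 < z.im)
    (hw : w * (c * z + d) = a * z + b) :
    etaInv t w = ((c * z + d) ^ (4 * t))⁻¹ * etaInv t z := by
  rw [etaInv, etaInv, eta_pow_eight_of_moebius hdet he hz hw, pow_mul, mul_inv, mul_pow, inv_pow]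

lemma etaInv_add_three_mul (t : ℕ) (z : ℂ) (n : ℤ) : etaInv t (z + 3 * n) = etaInv t z := by
  have h : Function.Periodic (etaInv t) 3 := by
    intro w
    have h1 : (ZMod.stdAddChar (1 : ZMod 3) : ℂ) ^ 3 = 1 := by
      rw [← AddChar.map_nsmul_eq_pow]
      exact AddChar.map_zero_eq_one _
    rw [etaInv, etaInv, show w + 3 = w + 1 + 1 + 1 by ring, eta_add_one_pow_eight,
      eta_add_one_pow_eight, eta_add_one_pow_eight, ← mul_assoc, ← mul_assoc]
    congr 2
    linear_combination h1 * η w ^ 8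
  have := h.int_mul n z
  rwa [mul_comm] at this

section Hecke

variable (p t : ℕ)

/-- The summand `η⁻⁸ᵗ ((z + 24 * x) / p)` of the Hecke operator at `p`. -/
noncomputable def heckeTerm (x : ZMod p) (z : ℂ) : ℂ := etaInv t ((z + 24 * (x.val : ℂ)) / p)

/-- `η⁸ᵖᵗ` times the image of `η⁻⁸ᵗ` under the Hecke operator at `p`. -/
noncomputable def heckeForm [NeZero p] (z : ℂ) : ℂ :=
  (η z ^ 8) ^ (p * t) *
    ((p : ℂ) ^ (4 * t) * ∑ x : ZMod p, heckeTerm p t x z + etaInv t (p * z))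

variable {p}

lemma heckeTerm_eq [NeZero p] (i : ℤ) (z : ℂ) :
    heckeTerm p t (i : ZMod p) z = etaInv t ((z + 24 * i) / p) := by
  obtain ⟨n, hn⟩ : (p : ℤ) ∣ i - ((i : ZMod p).val : ℤ) := by
    rw [← ZMod.intCast_zmod_eq_zero_iff_dvd]
    simp
  have hp : (p : ℂ) ≠ 0 := NeZero.ne _
  have h : (i : ℂ) - ((i : ZMod p).val : ℂ) = p * n := by exact_mod_cast congrArg (Int.cast : ℤ → ℂ) hn
  rw [heckeTerm, ← etaInv_add_three_mul t _ (8 * n)]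
  congr 1
  push_cast
  field_simp
  linear_combination (-24) * h

lemma natCast_576_ne_zero [Fact p.Prime] (hp5 : 5 ≤ p) : (576 : ZMod p) ≠ 0 := by
  have h2 : (2 : ZMod p) ≠ 0 := by
    intro h
    have := (ZMod.natCast_eq_zero_iff 2 p).mp (by exact_mod_cast h)
    have := Nat.le_of_dvd (by norm_num) this
    omega
  have h3 : (3 : ZMod p) ≠ 0 := by
    intro h
    have := (ZMod.natCast_eq_zero_iff 3 p).mp (by exact_mod_cast h)
    have := Nat.le_of_dvd (by norm_num) this
    omega
  rw [show (576 : ZMod p) = 2 ^ 6 * 3 ^ 2 by norm_num]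
  exact mul_ne_zero (pow_ne_zero _ h2) (pow_ne_zero _ h3)

lemma heckeTerm_neg_one_div [Fact p.Prime] (hp5 : 5 ≤ p) (x : ZMod p) (hx : x ≠ 0) {z : ℂ}
    (hz : 0 < z.im) : heckeTerm p t x (-1 / z) =
      (z ^ (4 * t))⁻¹ * heckeTerm p t (-(576⁻¹ * x⁻¹)) z := by
  have hp := Fact.out (p := p.Prime)
  have h576 := natCast_576_ne_zero hp5
  set y : ZMod p := -(576⁻¹ * x⁻¹) with hy
  set i : ℤ := (x.val : ℤ) with hi
  set j : ℤ := (y.val : ℤ) with hj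
  have hix : (i : ZMod p) = x := by simp [hi]
  have hjy : (j : ZMod p) = y := by simp [hj]
  obtain ⟨n, hn⟩ : (p : ℤ) ∣ 576 * i * j + 1 := by
    rw [← ZMod.intCast_zmod_eq_zero_iff_dvd]
    push_cast
    rw [hix, hjy, hy]
    field_simp
    simp
  have hz0 : z ≠ 0 := by rintro rfl; simp at hz
  have hp0 : (p : ℂ) ≠ 0 := by exact_mod_cast hp.ne_zero
  have hnC : 576 * (i : ℂ) * j + 1 = p * n := by exact_mod_cast congrArg (Int.cast : ℤ → ℂ) hn
  rw [← hix, ← hjy, heckeTerm_eq, heckeTerm_eq]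
  have him : 0 < ((z + 24 * (j : ℂ)) / p).im := by
    rw [Complex.div_natCast_im]
    have : (z + 24 * (j : ℂ)).im = z.im := by simp
    rw [this]
    have : 0 < p := hp.pos
    positivity
  have hden : (((p : ℤ) : ℂ) * ((z + 24 * (j : ℂ)) / p) + ((-24 * j : ℤ) : ℂ)) = z := by
    push_cast
    field_simp
    ring
  have := etaInv_of_moebius t (a := 24 * i) (b := -n) (c := p) (d := -24 * j)
    (z := (z + 24 * (j : ℂ)) / p) (w := (-1 / z + 24 * (i : ℂ)) / p)
    (by linear_combination -hn) ?_ him ?_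
  · rw [hden] at this
    exact this
  · push_cast
    rw [show (24 : ZMod 3) = 0 from rfl]
    ring
  · rw [hden]
    push_cast
    field_simp
    linear_combination -hnC

lemma sum_heckeTerm_neg_one_div [Fact p.Prime] (hp5 : 5 ≤ p) {z : ℂ} (hz : 0 < z.im) :
    (p : ℂ) ^ (4 * t) * ∑ x : ZMod p, heckeTerm p t x (-1 / z) + etaInv t (p * (-1 / z)) =
    (z ^ (4 * t))⁻¹ *
      ((p : ℂ) ^ (4 * t) * ∑ x : ZMod p, heckeTerm p t x z + etaInv t (p * z)) := by
  have hp := Fact.out (p := p.Prime)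
  have hz0 : z ≠ 0 := by rintro rfl; simp at hz
  have hp0 : (p : ℂ) ≠ 0 := by exact_mod_cast hp.ne_zero
  have hppos : 0 < (p : ℝ) := by exact_mod_cast hp.pos
  have hzero : ∀ w, heckeTerm p t 0 w = etaInv t (w / p) := by intro w; simp [heckeTerm]
  have h0 : heckeTerm p t 0 (-1 / z) = (z ^ (4 * t))⁻¹ * ((p : ℂ) ^ (4 * t))⁻¹ * etaInv t (p * z) := by
    have := etaInv_of_moebius t (a := 0) (b := -1) (c := 1) (d := 0) (z := p * z) (w := -1 / z / p)
      (by norm_num) (by simp) (by simpa using mul_pos hppos hz) (by push_cast; field_simp; ring)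
    rw [hzero, this]
    simp [mul_pow]
  have h1 : etaInv t (p * (-1 / z)) =
      (z ^ (4 * t))⁻¹ * (p : ℂ) ^ (4 * t) * heckeTerm p t 0 z := by
    have := etaInv_of_moebius t (a := 0) (b := -1) (c := 1) (d := 0) (z := z / p)
      (w := p * (-1 / z)) (by norm_num) (by simp)
      (by rw [Complex.div_natCast_im]; positivity) (by push_cast; field_simp; ring)
    rw [hzero, this]
    push_cast
    rw [one_mul, add_zero, div_pow]
    field_simp
  have h2 : ∀ x : ZMod p, heckeTerm p t x (-1 / z) =
      (z ^ (4 * t))⁻¹ * heckeTerm p t (-(576⁻¹ * x⁻¹)) z +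
      if x = 0 then heckeTerm p t 0 (-1 / z) - (z ^ (4 * t))⁻¹ * heckeTerm p t 0 z else 0 := by
    intro x
    split_ifs with hx
    · rw [hx, inv_zero, mul_zero, neg_zero]; ring
    · rw [heckeTerm_neg_one_div t hp5 x hx hz, add_zero]
  have hinv : Function.Involutive fun x : ZMod p ↦ -(576⁻¹ * x⁻¹) := by
    intro x
    have h576 := natCast_576_ne_zero hp5
    change -(576⁻¹ * (-(576⁻¹ * x⁻¹))⁻¹) = x
    rw [inv_neg, mul_inv, inv_inv, inv_inv]
    field_simp
  have h3 := Equiv.sum_comp hinv.toPerm fun x ↦ heckeTerm p t x z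
  simp only [Function.Involutive.coe_toPerm] at h3
  rw [Finset.sum_congr rfl fun x _ ↦ h2 x, Finset.sum_add_distrib, ← Finset.mul_sum, h3]
  simp only [Finset.sum_ite_eq', Finset.mem_univ, if_true]
  rw [h0, h1]
  field_simp
  ring

lemma heckeForm_neg_one_div [Fact p.Prime] (hp5 : 5 ≤ p) (z : ℍ) :
    heckeForm p t (-1 / (z : ℂ)) = (z : ℂ) ^ (4 * (t * (p - 1))) * heckeForm p t z := by
  have hp := Fact.out (p := p.Prime)
  obtain ⟨m, hm⟩ : ∃ m, p = m + 1 := ⟨p - 1, by omega⟩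
  rw [heckeForm, sum_heckeTerm_neg_one_div t hp5 z.2, eta_neg_one_div_pow_eight, heckeForm]
  have hz := z.ne_zero
  have : (z : ℂ) ^ (4 * (p * t)) = (z : ℂ) ^ (4 * (t * (p - 1))) * (z : ℂ) ^ (4 * t) := by
    rw [← pow_add, hm]; congr 1; simp; ring
  rw [mul_pow, ← pow_mul, this]
  field_simp

end Hecke

lemma exists_modularForm_of_seriesOnDisc {k : ℕ} {C : PowerSeries ℂ} {F : ℂ → ℂ}
    (hC : SeriesOnDisc C F)
    (hS : ∀ z : ℍ, F (Function.Periodic.qParam 1 (-1 / (z : ℂ))) =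
      (z : ℂ) ^ k * F (Function.Periodic.qParam 1 (z : ℂ))) :
    ∃ f : ModularForm 𝒮ℒ (k : ℤ), qExpansion 1 f = C := by
  set g : ℍ → ℂ := fun z ↦ F (Function.Periodic.qParam 1 (z : ℂ)) with hg
  have hnorm : ∀ z : ℍ, ‖Function.Periodic.qParam 1 (z : ℂ)‖ < 1 := fun z ↦ by
    exact_mod_cast norm_qParam_lt_one 1 z
  have hsum : ∀ τ : ℍ, HasSum (fun n ↦ C.coeff n • Function.Periodic.qParam 1 (τ : ℂ) ^ n) (g τ) :=
    fun τ ↦ by simpa [smul_eq_mul] using hC _ (hnorm τ)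
  have hSl : g ∣[(k : ℤ)] ModularGroup.S = g := by
    ext z
    have hz := pow_ne_zero k z.ne_zero
    have hs : (-(z : ℂ))⁻¹ = -1 / (z : ℂ) := by simp [neg_div]
    rw [SL_slash_apply, UpperHalfPlane.modular_S_smul]
    simp only [hg]
    rw [hs, hS z]
    have hd : denom (ModularGroup.S : GL (Fin 2) ℝ) z = z := by
      rw [ModularGroup.denom_apply]
      simp [ModularGroup.coe_S]
    rw [hd, zpow_neg, zpow_natCast]
    field_simp
  have hT : g ∣[(k : ℤ)] ModularGroup.T = g := by
    ext z
    have hd : denom (ModularGroup.T : GL (Fin 2) ℝ) z = 1 := by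
      rw [ModularGroup.denom_apply]
      simp [ModularGroup.coe_T]
    rw [SL_slash_apply, modular_T_smul, hd]
    simp [hg, Function.Periodic.qParam, mul_add, Complex.exp_add]
  let f : ModularForm 𝒮ℒ (k : ℤ) :=
    { toFun := g
      slash_action_eq' := by
        rintro A ⟨A, rfl⟩
        exact SlashInvariantForm.slash_action_generators_SL2Z hSl hT A
      holo' := by
        rw [UpperHalfPlane.mdifferentiable_iff]
        have hF : DifferentiableOn ℂ F (Metric.ball 0 1) := by
          have := hC.hasFPowerSeriesOnBall.differentiableOn
          rwa [show Metric.eball (0 : ℂ) 1 = Metric.ball 0 1 by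
            rw [← ENNReal.ofReal_one, Metric.eball_ofReal]] at this
        have hF2 : DifferentiableOn ℂ (fun z ↦ F (Function.Periodic.qParam 1 z)) {z | 0 < z.im} :=
          hF.comp (by fun_prop) fun z hz ↦ by simpa using hnorm ⟨z, hz⟩
        refine hF2.congr fun z hz ↦ ?_
        simp [hg, ofComplex_apply_of_im_pos hz]
      bdd_at_cusps' := by
        intro c hc
        rw [Subgroup.IsArithmetic.isCusp_iff_isCusp_SL2Z] at hc
        rw [OnePoint.isBoundedAt_iff_forall_SL2Z hc]
        intro γ _
        rw [SlashInvariantForm.slash_action_generators_SL2Z hSl hT]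
        exact isBoundedAtImInfty_of_hasSum_qExpansion one_pos hsum }
  have hsum' : ∀ τ : ℍ, HasSum
      (fun n ↦ C.coeff n • Function.Periodic.qParam 1 (τ : ℂ) ^ n) (f τ) := hsum
  refine ⟨f, ?_⟩
  ext n
  exact (ModularFormClass.qExpansion_coeff_unique one_pos one_mem_strictPeriods_SL hsum' n).symm

lemma SeriesOnDisc.exists_progression {A : PowerSeries ℂ} {F : ℂ → ℂ} (hA : SeriesOnDisc A F)
    {p : ℕ} [Fact p.Prime] {u : ZMod p} (hu : u ≠ 0) {r : ℕ} (hr : r < p) :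
    ∃ U : ℂ → ℂ, SeriesOnDisc (PowerSeries.mk fun m ↦ A.coeff (p * m + r)) U ∧
      ∀ w : ℂ, ‖w‖ < 1 → ∑ x : ZMod p, ZMod.stdAddChar (-(u * x * (r : ZMod p))) *
        F (ZMod.stdAddChar (u * x) * w) = p * w ^ r * U (w ^ p) := by
  have hp := Fact.out (p := p.Prime)
  have hp0 : (p : ℂ) ≠ 0 := by exact_mod_cast hp.ne_zero
  have hinj : Function.Injective fun m : ℕ ↦ p * m + r := by
    intro a b hab
    have : p * a = p * b := by simpa using hab
    exact Nat.eq_of_mul_eq_mul_left hp.pos this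
  have key : ∀ w : ℂ, ‖w‖ < 1 → HasSum (fun m ↦ p * w ^ r * (A.coeff (p * m + r) * (w ^ p) ^ m))
      (∑ x : ZMod p, ZMod.stdAddChar (-(u * x * (r : ZMod p))) * F (ZMod.stdAddChar (u * x) * w)) := by
    intro w hw
    have h1 : ∀ x : ZMod p, HasSum (fun n ↦ ZMod.stdAddChar (-(u * x * (r : ZMod p))) *
        (A.coeff n * (ZMod.stdAddChar (u * x) * w) ^ n))
        (ZMod.stdAddChar (-(u * x * (r : ZMod p))) * F (ZMod.stdAddChar (u * x) * w)) := by
      intro x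
      refine (hA _ ?_).mul_left _
      rwa [norm_mul, AddChar.norm_apply, one_mul]
    have h2 := hasSum_sum (s := Finset.univ) fun x _ ↦ h1 x
    have h3 : ∀ n : ℕ, ∑ x : ZMod p, ZMod.stdAddChar (-(u * x * (r : ZMod p))) *
        (A.coeff n * (ZMod.stdAddChar (u * x) * w) ^ n) =
        if (n : ZMod p) = r then p * (A.coeff n * w ^ n) else 0 := by
      intro n
      have h4 : ∀ x : ZMod p, ZMod.stdAddChar (-(u * x * (r : ZMod p))) *
        (A.coeff n * (ZMod.stdAddChar (u * x) * w) ^ n) =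
        ZMod.stdAddChar (x * (u * ((n : ZMod p) - (r : ZMod p)))) * (A.coeff n * w ^ n) := by
        intro x
        rw [show x * (u * ((n : ZMod p) - (r : ZMod p))) = -(u * x * (r : ZMod p)) + n • (u * x) by
          rw [nsmul_eq_mul]; ring, AddChar.map_add_eq_mul, AddChar.map_nsmul_eq_pow]
        ring
      rw [Finset.sum_congr rfl fun x _ ↦ h4 x, ← Finset.sum_mul,
        AddChar.sum_mulShift _ (ZMod.isPrimitive_stdAddChar p), ZMod.card]
      simp only [mul_eq_zero, hu, false_or, sub_eq_zero]
      split_ifs <;> simp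
    simp_rw [h3] at h2
    rw [← hinj.hasSum_iff] at h2
    · convert h2 using 2 with m
      simp
      ring
    · intro n hn
      rw [if_neg]
      intro h
      apply hn
      rw [ZMod.natCast_eq_natCast_iff, Nat.ModEq, Nat.mod_eq_of_lt hr] at h
      exact ⟨n / p, by change p * (n / p) + r = n; rw [← h, Nat.div_add_mod]⟩
  refine ⟨fun q ↦ ∑' m, A.coeff (p * m + r) * q ^ m, ?_, ?_⟩
  · intro q hq
    simp only [PowerSeries.coeff_mk]
    apply Summable.hasSum
    obtain ⟨w, hw⟩ := IsAlgClosed.exists_pow_nat_eq q hp.pos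
    rcases eq_or_ne w 0 with rfl | hw0
    · rw [zero_pow hp.ne_zero] at hw
      subst hw
      exact (hasSum_single 0 fun n hn ↦ by simp [hn]).summable
    · have hw1 : ‖w‖ < 1 := by
        rw [← hw, norm_pow] at hq
        exact (pow_lt_one_iff_of_nonneg (norm_nonneg _) hp.ne_zero).mp hq
      have := (key w hw1).summable
      rw [hw] at this
      exact (summable_mul_left_iff (mul_ne_zero hp0 (pow_ne_zero _ hw0))).mp this
  · intro w hw
    rw [← (key w hw).tsum_eq, tsum_mul_left]

lemma eta_pow_eight_eq (z : ℂ) :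
    η z ^ 8 = Function.Periodic.qParam 3 z * eulerPhi (Function.Periodic.qParam 1 z) ^ 8 := by
  rw [ModularForm.eta, mul_pow]
  congr 1
  rw [Function.Periodic.qParam, Function.Periodic.qParam, ← Complex.exp_nat_mul]
  congr 1
  push_cast
  ring

lemma etaInv_eq (t : ℕ) (z : ℂ) : etaInv t z = (Function.Periodic.qParam 3 z ^ t)⁻¹ *
    (eulerPhi (Function.Periodic.qParam 1 z))⁻¹ ^ (8 * t) := by
  rw [etaInv, eta_pow_eight_eq, pow_mul, mul_inv, mul_pow, inv_pow, inv_pow _ 8]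

/-- The integral `q`-expansion of `heckeForm p t`. -/
noncomputable def heckeSeries (p t r K : ℕ) (hp : p ≠ 0) : PowerSeries ℤ :=
  PowerSeries.pentagonalSeries ℤ ^ (8 * (p * t)) *
    (PowerSeries.C ((p : ℤ) ^ (4 * t + 1)) * PowerSeries.X ^ K *
      PowerSeries.mk (fun m ↦ (partitionSeries ^ (8 * t)).coeff (p * m + r)) +
      PowerSeries.expand p hp (partitionSeries ^ (8 * t)))

lemma stdAddChar_natCast {p : ℕ} [NeZero p] (n : ℕ) :
    (ZMod.stdAddChar (n : ZMod p) : ℂ) = cexp (2 * Real.pi * I * n / p) := by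
  have := ZMod.stdAddChar_coe (N := p) n
  simpa using this

lemma natCast_24_ne_zero {p : ℕ} [Fact p.Prime] (hp5 : 5 ≤ p) : (24 : ZMod p) ≠ 0 := by
  intro h
  apply natCast_576_ne_zero hp5
  rw [show (576 : ZMod p) = 24 * 24 by norm_num, h, zero_mul]

lemma exists_heckeForm_seriesOnDisc {p t r K : ℕ} [Fact p.Prime] (hp5 : 5 ≤ p) (hr : r < p)
    (hK : p * p * t + 3 * r = 3 * p * K + t) (hp : p ≠ 0) :
    ∃ F : ℂ → ℂ, SeriesOnDisc ((heckeSeries p t r K hp).map (Int.castRingHom ℂ)) F ∧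
      ∀ z : ℂ, 0 < z.im → heckeForm p t z = F (Function.Periodic.qParam 1 z) := by
  have hp0 : (p : ℂ) ≠ 0 := by exact_mod_cast hp
  have hA : SeriesOnDisc ((partitionSeries ^ (8 * t)).map (Int.castRingHom ℂ))
      (fun q ↦ (eulerPhi q)⁻¹ ^ (8 * t)) := by
    rw [map_pow]
    exact seriesOnDisc_partitionSeries.pow _
  obtain ⟨U, hU, hU2⟩ := hA.exists_progression (natCast_24_ne_zero hp5) hr
  have hc := SeriesOnDisc.of_polynomial
    (Polynomial.C ((p : ℂ) ^ (4 * t + 1)) * Polynomial.X ^ K)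
  have hB := (seriesOnDisc_eulerPhi.pow (8 * (p * t))).mul ((hc.mul hU).add (hA.expand hp))
  have hseries : (heckeSeries p t r K hp).map (Int.castRingHom ℂ) =
      PowerSeries.pentagonalSeries ℂ ^ (8 * (p * t)) *
        (((Polynomial.C ((p : ℂ) ^ (4 * t + 1)) * Polynomial.X ^ K : Polynomial ℂ) :
          PowerSeries ℂ) * PowerSeries.mk (fun m ↦
          ((partitionSeries ^ (8 * t)).map (Int.castRingHom ℂ)).coeff (p * m + r)) +
          PowerSeries.expand p hp ((partitionSeries ^ (8 * t)).map (Int.castRingHom ℂ))) := by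
    have hmk : (PowerSeries.mk fun m ↦ (partitionSeries ^ (8 * t)).coeff (p * m + r)).map
        (Int.castRingHom ℂ) = PowerSeries.mk fun m ↦
        ((partitionSeries ^ (8 * t)).map (Int.castRingHom ℂ)).coeff (p * m + r) := by
      ext m
      rw [PowerSeries.coeff_map, PowerSeries.coeff_mk, PowerSeries.coeff_mk, PowerSeries.coeff_map]
    rw [heckeSeries, map_mul, map_add, map_mul, map_mul, PowerSeries.map_expand, hmk, map_pow,
      map_pentagonalSeries, PowerSeries.map_C, map_pow _ PowerSeries.X, PowerSeries.map_X, Polynomial.coe_mul, Polynomial.coe_C, Polynomial.coe_pow,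
      Polynomial.coe_X, map_pow (Int.castRingHom ℂ), map_natCast]
  refine ⟨_, hseries ▸ hB, fun z hz ↦ ?_⟩
  set v : ℂ := cexp (2 * Real.pi * I * z / (3 * p)) with hv
  have hv0 : v ≠ 0 := Complex.exp_ne_zero _
  have h3 : Function.Periodic.qParam 3 z = v ^ p := by
    rw [hv, ← Complex.exp_nat_mul, Function.Periodic.qParam]
    congr 1
    push_cast
    field_simp
  have h1 : Function.Periodic.qParam 1 z = v ^ (3 * p) := by
    rw [hv, ← Complex.exp_nat_mul, Function.Periodic.qParam]
    congr 1
    push_cast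
    field_simp
  have hnorm : ‖v ^ 3‖ < 1 := by
    have h : ‖v ^ (3 * p)‖ < 1 := by
      rw [← h1]
      exact_mod_cast norm_qParam_lt_one 1 ⟨z, hz⟩
    rw [pow_mul, norm_pow] at h
    exact (pow_lt_one_iff_of_nonneg (norm_nonneg _) hp).mp h
  have hterm : ∀ x : ZMod p, heckeTerm p t x z = (v ^ t)⁻¹ *
      (ZMod.stdAddChar (-(24 * x * (r : ZMod p))) *
        (eulerPhi (ZMod.stdAddChar (24 * x) * v ^ 3))⁻¹ ^ (8 * t)) := by
    intro x
    have hx : ((x.val : ℕ) : ZMod p) = x := by simp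
    have e1 : Function.Periodic.qParam 1 ((z + 24 * (x.val : ℂ)) / p) =
        ZMod.stdAddChar (24 * x) * v ^ 3 := by
      have : 24 * x = ((24 * x.val : ℕ) : ZMod p) := by push_cast; rw [hx]
      rw [this, stdAddChar_natCast, hv, ← Complex.exp_nat_mul, ← Complex.exp_add,
        Function.Periodic.qParam]
      congr 1
      push_cast
      field_simp
      ring
    have e3 : Function.Periodic.qParam 3 ((z + 24 * (x.val : ℂ)) / p) =
        ZMod.stdAddChar (8 * x) * v := by
      have : 8 * x = ((8 * x.val : ℕ) : ZMod p) := by push_cast; rw [hx]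
      rw [this, stdAddChar_natCast, hv, ← Complex.exp_add, Function.Periodic.qParam]
      congr 1
      push_cast
      field_simp
      ring
    have e4 : (ZMod.stdAddChar (-(24 * x * (r : ZMod p))) : ℂ) =
        ((ZMod.stdAddChar (8 * x) : ℂ) ^ t)⁻¹ := by
      rw [← AddChar.map_nsmul_eq_pow, ← AddChar.map_neg_eq_inv]
      congr 2
      have := congrArg (Nat.cast : ℕ → ZMod p) hK
      push_cast at this
      rw [CharP.cast_eq_zero] at this
      rw [nsmul_eq_mul]
      linear_combination 8 * x * this
    rw [heckeTerm, etaInv_eq, e1, e3, e4, mul_pow, mul_inv]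
    ring
  have hpz : Function.Periodic.qParam 3 (p * z) = (v ^ p) ^ p := by
    rw [← h3, Function.Periodic.qParam, Function.Periodic.qParam, ← Complex.exp_nat_mul]
    congr 1
    ring
  have hpz1 : Function.Periodic.qParam 1 (p * z) = (v ^ (3 * p)) ^ p := by
    rw [← h1, Function.Periodic.qParam, Function.Periodic.qParam, ← Complex.exp_nat_mul]
    congr 1
    ring
  rw [heckeForm, Finset.sum_congr rfl fun x _ ↦ hterm x, ← Finset.mul_sum, hU2 _ hnorm, etaInv_eq,
    eta_pow_eight_eq, hpz, hpz1, h1, h3]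
  have hvK : (v ^ p) ^ (p * t) * (v ^ t)⁻¹ * (v ^ 3) ^ r = (v ^ (3 * p)) ^ K := by
    have : v ^ (p * p * t + 3 * r) = v ^ (3 * p * K + t) := by rw [hK]
    field_simp
    simp only [← pow_mul, ← pow_add]
    rw [← mul_assoc, this, add_comm t]
  have hvp : (v ^ p) ^ (p * t) * (((v ^ p) ^ p) ^ t)⁻¹ = 1 := by
    rw [← pow_mul _ p t]
    exact mul_inv_cancel₀ (pow_ne_zero _ (pow_ne_zero _ hv0))
  simp only [Polynomial.eval_mul, Polynomial.eval_C, Polynomial.eval_pow, Polynomial.eval_X]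
  rw [← pow_mul v 3 p, mul_pow, ← pow_mul _ 8 (p * t)]
  set P := eulerPhi (v ^ (3 * p)) ^ (8 * (p * t))
  set A := (eulerPhi ((v ^ (3 * p)) ^ p))⁻¹ ^ (8 * t)
  linear_combination P * p ^ (4 * t + 1) * U (v ^ (3 * p)) * hvK + P * A * hvp

lemma exists_heckeSeries_eq_sum {p t r K : ℕ} [Fact p.Prime] (hp5 : 5 ≤ p) (hr : r < p)
    (hK : p * p * t + 3 * r = 3 * p * K + t) (hp : p ≠ 0) :
    ∃ c : ℕ → ℤ, heckeSeries p t r K hp = ∑ j ∈ Finset.range (t * (p - 1) / 3 + 1),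
      PowerSeries.C (c j) *
        (eisensteinFourSeries ^ (t * (p - 1) - 3 * j) * discriminantSeries ^ j) := by
  obtain ⟨F, hF, hF2⟩ := exists_heckeForm_seriesOnDisc hp5 hr hK hp
  obtain ⟨f, hf⟩ := exists_modularForm_of_seriesOnDisc (k := 4 * (t * (p - 1))) hF fun z ↦ by
    have hz : 0 < (-1 / (z : ℂ)).im := by
      have := z.im_inv_neg_coe_pos
      rwa [show (-(z : ℂ))⁻¹ = -1 / (z : ℂ) by simp [neg_div]] at this
    rw [← hF2 _ hz, ← hF2 _ z.2, heckeForm_neg_one_div t hp5]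
  exact exists_integral_combination _ f _ hf

end

section

open PowerSeries

lemma expand_two_pow_eq_pow (k : ℕ) (A : PowerSeries (ZMod 2)) :
    A ^ 2 ^ k = PowerSeries.expand (2 ^ k) (by positivity) A := by
  have : ExpChar (ZMod 2) 2 := ExpChar.prime Nat.prime_two
  have h : iterateFrobenius (ZMod 2) 2 k = RingHom.id _ := Subsingleton.elim _ _
  have := MvPowerSeries.map_iterateFrobenius_expand (σ := Unit) 2 two_ne_zero A k
  rw [h, MvPowerSeries.map_id] at this
  exact this.symm

/-- The reduction modulo `2` of the partition generating series. -/
noncomputable def partitionSeriesModTwo : PowerSeries (ZMod 2) :=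
  partitionSeries.map (Int.castRingHom (ZMod 2))

lemma coeff_partitionSeriesModTwo_pow (t n : ℕ) :
    (partitionSeriesModTwo ^ t).coeff n = (multipartition t n : ZMod 2) := by
  rw [partitionSeriesModTwo, ← map_pow, coeff_map, coeff_partitionSeries_pow]
  simp

lemma partitionSeriesModTwo_pow_eight_mul (s : ℕ) :
    partitionSeriesModTwo ^ (8 * s) =
      PowerSeries.expand 8 (by norm_num) (partitionSeriesModTwo ^ s) := by
  rw [mul_comm, pow_mul]
  exact expand_two_pow_eq_pow 3 _

lemma partitionSeriesModTwo_mul : partitionSeriesModTwo * pentagonalSeries (ZMod 2) = 1 := by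
  rw [partitionSeriesModTwo, ← map_pentagonalSeries, ← map_mul,
    partitionSeries_mul_pentagonalSeries, map_one]

lemma eisensteinFourSeries_modTwo :
    eisensteinFourSeries.map (Int.castRingHom (ZMod 2)) = 1 := by
  have h : (240 : PowerSeries (ZMod 2)) = 0 := by
    rw [show (240 : PowerSeries (ZMod 2)) = PowerSeries.C (240 : ZMod 2) from
      (map_ofNat PowerSeries.C 240).symm,
      show (240 : ZMod 2) = 0 from rfl, map_zero]
  rw [eisensteinFourSeries, map_add, map_one, map_mul, map_ofNat, h, zero_mul, add_zero]

lemma heckeSeries_modTwo {p t r K : ℕ} [Fact p.Prime] (hp5 : 5 ≤ p) (hr : r < p)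
    (hK : p * p * t + 3 * r = 3 * p * K + t) (hp : p ≠ 0) :
    ∃ c : ℕ → ZMod 2, X ^ K * PowerSeries.mk (fun m ↦
        (partitionSeriesModTwo ^ (8 * t)).coeff (p * m + r)) +
        PowerSeries.expand p hp (partitionSeriesModTwo ^ (8 * t)) =
      ∑ j ∈ Finset.range (t * (p - 1) / 3 + 1),
        PowerSeries.C (c j) * (X ^ j * partitionSeriesModTwo ^ (8 * (p * t - 3 * j))) := by
  obtain ⟨c, hc⟩ := exists_heckeSeries_eq_sum hp5 hr hK hp
  refine ⟨fun j ↦ c j, ?_⟩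
  have hodd : ((p : ℤ) : ZMod 2) = 1 := by
    have := (Fact.out (p := p.Prime)).odd_of_ne_two (by omega)
    simpa using ZMod.natCast_eq_one_iff_odd.mpr this
  have h1 := congrArg (fun A ↦ A.map (Int.castRingHom (ZMod 2)) *
    partitionSeriesModTwo ^ (8 * (p * t))) hc
  have hmk : (PowerSeries.mk fun m ↦ (partitionSeries ^ (8 * t)).coeff (p * m + r)).map
      (Int.castRingHom (ZMod 2)) =
      PowerSeries.mk fun m ↦ (partitionSeriesModTwo ^ (8 * t)).coeff (p * m + r) := by
    ext m
    rw [PowerSeries.coeff_map, PowerSeries.coeff_mk, PowerSeries.coeff_mk, partitionSeriesModTwo,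
      ← map_pow, PowerSeries.coeff_map]
  have hpow : ∀ n, pentagonalSeries (ZMod 2) ^ n * partitionSeriesModTwo ^ n = 1 := fun n ↦ by
    rw [← mul_pow, mul_comm, partitionSeriesModTwo_mul, one_pow]
  have hC : (PowerSeries.C ((p : ℤ) ^ (4 * t + 1))).map (Int.castRingHom (ZMod 2)) = 1 := by
    rw [PowerSeries.map_C, eq_intCast, Int.cast_pow, hodd, one_pow, map_one]
  have hpP : ∀ n, (partitionSeries ^ n).map (Int.castRingHom (ZMod 2)) =
      partitionSeriesModTwo ^ n := fun n ↦ by rw [map_pow, partitionSeriesModTwo]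
  have hpQ : ∀ n, (pentagonalSeries ℤ ^ n).map (Int.castRingHom (ZMod 2)) =
      pentagonalSeries (ZMod 2) ^ n := fun n ↦ by rw [map_pow, map_pentagonalSeries]
  simp only [heckeSeries, map_mul, map_add, map_sum, hC, hpQ, hmk, one_mul,
    PowerSeries.map_expand, hpP, Finset.sum_mul] at h1
  rw [mul_right_comm, hpow, one_mul, map_pow, PowerSeries.map_X] at h1
  rw [h1]
  refine Finset.sum_congr rfl fun j hj ↦ ?_
  rw [PowerSeries.map_C, eq_intCast, map_pow, map_pow, eisensteinFourSeries_modTwo, one_pow,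
    one_mul, discriminantSeries, map_mul, hpQ, PowerSeries.map_X, mul_pow, ← pow_mul]
  have hj' : 3 * j ≤ t * (p - 1) := by
    have := Finset.mem_range.mp hj
    omega
  have hle : t * (p - 1) ≤ p * t := by
    rw [mul_comm]
    exact Nat.mul_le_mul_right _ (Nat.sub_le _ _)
  have hsplit : 8 * (p * t) = 24 * j + 8 * (p * t - 3 * j) := by omega
  rw [hsplit, pow_add]
  linear_combination (PowerSeries.C (c j : ZMod 2) * X ^ j *
    partitionSeriesModTwo ^ (8 * (p * t - 3 * j))) * hpow (24 * j)

lemma multipartition_zero_right (s : ℕ) : multipartition s 0 = 1 := by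
  simp [multipartition, Finset.Nat.antidiagonalTuple_zero_right]

lemma exists_sum_multipartition_eq {p t D : ℕ} [Fact p.Prime] (hp5 : 5 ≤ p) (ht : 0 < t)
    (hD : 24 * D + t = p * p * t) :
    ∃ c : ℕ → ZMod 2, c 0 = 1 ∧ ∀ n : ℕ,
      (if D ≤ p * n then (multipartition t (p * n - D) : ZMod 2) else 0) +
        (if p ∣ n then (multipartition t (n / p) : ZMod 2) else 0) =
      ∑ j ∈ Finset.range (t * (p - 1) / 24 + 1),
        if j ≤ n then c j * (multipartition (p * t - 24 * j) (n - j) : ZMod 2) else 0 := by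
  have hprime : p.Prime := Fact.out
  have hp : p ≠ 0 := by omega
  have h3 : ((3 : ℕ) : ZMod p) ≠ 0 := fun h ↦ by
    have := Nat.le_of_dvd (by norm_num) ((ZMod.natCast_eq_zero_iff 3 p).mp h)
    omega
  obtain ⟨r, hr, hrt⟩ : ∃ r < p, ∃ m : ℤ, (3 * r : ℤ) - t = p * m := by
    refine ⟨((t : ZMod p) * ((3 : ℕ) : ZMod p)⁻¹).val, ZMod.val_lt _, ?_⟩
    change (p : ℤ) ∣ _
    rw [← ZMod.intCast_zmod_eq_zero_iff_dvd]
    push_cast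
    rw [ZMod.natCast_zmod_val]
    push_cast at h3
    field_simp
    ring
  obtain ⟨K, hK⟩ : ∃ K : ℕ, p * p * t + 3 * r = 3 * p * K + t := by
    obtain ⟨m, hm⟩ := hrt
    have hpD : p ∣ r + 8 * D := by
      have h1 : (p : ℤ) ∣ 3 * (r + 8 * D) := ⟨m + p * t, by
        have : (24 * D + t : ℤ) = p * p * t := by exact_mod_cast hD
        linear_combination hm + this⟩
      have h2 : p ∣ 3 * (r + 8 * D) := by exact_mod_cast h1
      exact (Nat.Coprime.dvd_of_dvd_mul_left
        ((Nat.coprime_primes hprime Nat.prime_three).mpr (by omega)) h2)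
    obtain ⟨K, hK⟩ := hpD
    exact ⟨K, by linarith⟩
  have hpK : p * K = r + 8 * D := by linarith
  obtain ⟨c, hc⟩ := heckeSeries_modTwo hp5 hr hK hp
  have key : ∀ n : ℕ, (if D ≤ p * n then (multipartition t (p * n - D) : ZMod 2) else 0) +
        (if p ∣ n then (multipartition t (n / p) : ZMod 2) else 0) =
      ∑ j ∈ Finset.range (t * (p - 1) / 24 + 1),
        if j ≤ n then c (8 * j) * (multipartition (p * t - 24 * j) (n - j) : ZMod 2) else 0 := by
    intro n
    have hn := congrArg (PowerSeries.coeff (8 * n)) hc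
    have hleft : PowerSeries.coeff (8 * n) (X ^ K * PowerSeries.mk (fun m ↦
        (partitionSeriesModTwo ^ (8 * t)).coeff (p * m + r))) =
        if D ≤ p * n then (multipartition t (p * n - D) : ZMod 2) else 0 := by
      rw [coeff_X_pow_mul', coeff_mk]
      have hiff : K ≤ 8 * n ↔ D ≤ p * n := by
        constructor <;> intro h <;> by_contra! hlt
        · nlinarith
        · nlinarith
      by_cases h : D ≤ p * n
      · rw [if_pos h, if_pos (hiff.mpr h), partitionSeriesModTwo_pow_eight_mul]
        obtain ⟨e, he⟩ := Nat.exists_eq_add_of_le (hiff.mpr h)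
        obtain ⟨f, hf⟩ := Nat.exists_eq_add_of_le h
        rw [hf, Nat.add_sub_cancel_left, ← coeff_partitionSeriesModTwo_pow,
          show p * (8 * n - K) + r = 8 * f by
            rw [he, Nat.add_sub_cancel_left]; nlinarith, coeff_expand_mul]
      · rw [if_neg h, if_neg (mt hiff.mp h)]
    have hmid : PowerSeries.coeff (8 * n) (PowerSeries.expand p hp
        (partitionSeriesModTwo ^ (8 * t))) =
        if p ∣ n then (multipartition t (n / p) : ZMod 2) else 0 := by
      rw [coeff_expand, partitionSeriesModTwo_pow_eight_mul]
      have hcop : Nat.Coprime p 8 :=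
        (Nat.coprime_primes hprime Nat.prime_two |>.mpr (by omega)).pow_right 3
      by_cases h : p ∣ n
      · rw [if_pos h, if_pos (h.mul_left 8), Nat.mul_div_assoc _ h, coeff_expand_mul,
          coeff_partitionSeriesModTwo_pow]
      · rw [if_neg h, if_neg (mt hcop.dvd_of_dvd_mul_left h)]
    rw [map_add, hleft, hmid, map_sum] at hn
    rw [hn]
    have hterm : ∀ j, PowerSeries.coeff (8 * n) (PowerSeries.C (c j) * (X ^ j *
        partitionSeriesModTwo ^ (8 * (p * t - 3 * j)))) =
        if j ≤ 8 * n ∧ 8 ∣ j then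
          c j * (multipartition (p * t - 3 * j) (n - j / 8) : ZMod 2) else 0 := by
      intro j
      rw [coeff_C_mul, coeff_X_pow_mul', partitionSeriesModTwo_pow_eight_mul, coeff_expand]
      by_cases h : j ≤ 8 * n
      · by_cases h8 : 8 ∣ j
        · rw [if_pos h, if_pos (show 8 ∣ 8 * n - j by omega), if_pos ⟨h, h8⟩, coeff_partitionSeriesModTwo_pow]
          congr 3
          omega
        · rw [if_pos h, if_neg (show ¬ 8 ∣ 8 * n - j by omega), if_neg (by tauto), mul_zero]
      · rw [if_neg h, if_neg (by tauto), mul_zero]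
    simp_rw [hterm]
    rw [← Finset.sum_subset (s₁ := (Finset.range (t * (p - 1) / 24 + 1)).image (8 * ·)),
      Finset.sum_image (by intro x _ y _ h; simpa using h)]
    · refine Finset.sum_congr rfl fun j _ ↦ ?_
      by_cases h : j ≤ n
      · rw [if_pos h, if_pos ⟨by omega, dvd_mul_right _ _⟩,
          Nat.mul_div_cancel_left _ (by norm_num)]
        congr 4
        omega
      · rw [if_neg h, if_neg (by omega)]
    · intro j hj
      simp only [Finset.mem_image, Finset.mem_range] at hj ⊢
      omega
    · intro j hj hj'
      rw [if_neg]
      rintro ⟨_, i, rfl⟩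
      refine hj' (Finset.mem_image_of_mem _ ?_)
      simp only [Finset.mem_range] at hj ⊢
      omega
  refine ⟨fun j ↦ c (8 * j), ?_, key⟩
  have h0 := key 0
  have hDpos : ¬ D ≤ p * 0 := by
    have : 25 * t ≤ p * p * t := Nat.mul_le_mul_right _ (by nlinarith)
    omega
  rw [if_neg hDpos, Finset.sum_eq_single 0 (by intro j _ hj; rw [if_neg (by omega)]) (by simp)]
    at h0
  simpa [multipartition_zero_right] using h0.symm

end

/-- The coefficient of `q ^ N` in the reduction modulo `2` of
`q ^ (-s) / ∏ (1 - q ^ (24 * i)) ^ s`. -/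
def multipartitionShift (s : ℕ) (N : ℤ) : ZMod 2 :=
  if 24 ∣ N + s ∧ 0 ≤ N + s then (multipartition s ((N + s) / 24).toNat : ZMod 2) else 0

lemma multipartitionShift_of_eq {s n : ℕ} {N : ℤ} (h : N + s = 24 * n) :
    multipartitionShift s N = multipartition s n := by
  rw [multipartitionShift, if_pos ⟨⟨n, h⟩, by omega⟩, h,
    Int.mul_ediv_cancel_left _ (by norm_num), Int.toNat_natCast]

lemma multipartitionShift_of_forall_ne {s : ℕ} {N : ℤ} (h : ∀ n : ℕ, N + s ≠ 24 * n) :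
    multipartitionShift s N = 0 := by
  rw [multipartitionShift, if_neg]
  rintro ⟨⟨m, hm⟩, h0⟩
  refine h m.toNat ?_
  omega

/-- The operator sending `∑ f N q ^ N` to `∑ f (p * N) q ^ N`. -/
def dilate (p : ℕ) : (ℤ → ZMod 2) →ₗ[ZMod 2] (ℤ → ZMod 2) :=
  LinearMap.funLeft (ZMod 2) (ZMod 2) fun N : ℤ ↦ p * N

/-- The operator sending `∑ f N q ^ N` to `∑ f N q ^ (p * N)`. -/
def inflate (p : ℕ) : (ℤ → ZMod 2) →ₗ[ZMod 2] (ℤ → ZMod 2) where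
  toFun f N := if (p : ℤ) ∣ N then f (N / p) else 0
  map_add' f g := by
    ext N
    by_cases h : (p : ℤ) ∣ N <;> simp [h]
  map_smul' c f := by
    ext N
    by_cases h : (p : ℤ) ∣ N <;> simp [h]

lemma dilate_apply (p : ℕ) (f : ℤ → ZMod 2) (N : ℤ) : dilate p f N = f (p * N) := rfl

lemma inflate_apply (p : ℕ) (f : ℤ → ZMod 2) (N : ℤ) :
    inflate p f N = if (p : ℤ) ∣ N then f (N / p) else 0 := rfl

lemma dilate_inflate {p : ℕ} (hp : p ≠ 0) (f : ℤ → ZMod 2) : dilate p (inflate p f) = f := by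
  ext N
  rw [dilate_apply, inflate_apply, if_pos (dvd_mul_right _ _),
    Int.mul_ediv_cancel_left _ (by exact_mod_cast hp)]

lemma dilate_pow_apply (p α : ℕ) (f : ℤ → ZMod 2) (N : ℤ) :
    (dilate p ^ α) f N = f (p ^ α * N) := by
  induction α generalizing N with
  | zero => simp
  | succ α ih =>
    rw [pow_succ', Module.End.mul_apply, dilate_apply, ih, pow_succ, mul_assoc]

lemma exists_mul_self_eq_of_prime {p : ℕ} (hp : p.Prime) (hp5 : 5 ≤ p) :
    ∃ e : ℕ, p * p = 24 * e + 1 := by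
  have h2 : p % 2 = 1 := (hp.eq_two_or_odd).resolve_left (by omega)
  have h3 : p % 3 ≠ 0 := fun h ↦ by
    have := (Nat.prime_dvd_prime_iff_eq Nat.prime_three hp).mp (Nat.dvd_of_mod_eq_zero h)
    omega
  have h : p * p % 24 = 1 := by
    have hlt : p % 24 < 24 := Nat.mod_lt _ (by norm_num)
    have h2' : p % 24 % 2 = 1 := by omega
    have h3' : p % 24 % 3 ≠ 0 := by omega
    rw [Nat.mul_mod]
    generalize p % 24 = x at *
    interval_cases x <;> simp_all
  exact ⟨p * p / 24, by omega⟩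

lemma exists_dilate_add_inflate_eq {p t : ℕ} [Fact p.Prime] (hp5 : 5 ≤ p) (ht : 0 < t) :
    ∃ c : ℕ → ZMod 2, c 0 = 1 ∧
      dilate p (multipartitionShift t) + inflate p (multipartitionShift t) =
      ∑ j ∈ Finset.range (t * (p - 1) / 24 + 1), c j • multipartitionShift (p * t - 24 * j) := by
  have hprime : p.Prime := Fact.out
  obtain ⟨e, he⟩ := exists_mul_self_eq_of_prime hprime hp5
  have hD : 24 * (e * t) + t = p * p * t := by rw [he]; ring
  obtain ⟨c, hc0, hc⟩ := exists_sum_multipartition_eq hp5 ht hD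
  refine ⟨c, hc0, ?_⟩
  have hp0 : (0 : ℤ) < p := by omega
  have he' : (p * p : ℤ) = 24 * e + 1 := by exact_mod_cast he
  have hle : ∀ j ∈ Finset.range (t * (p - 1) / 24 + 1), 24 * j ≤ p * t := by
    intro j hj
    have : t * (p - 1) ≤ p * t := by
      rw [mul_comm]
      exact Nat.mul_le_mul_right _ (Nat.sub_le _ _)
    have := Finset.mem_range.mp hj
    omega
  ext N
  rw [Pi.add_apply, dilate_apply, inflate_apply, Finset.sum_apply]
  simp_rw [Pi.smul_apply, smul_eq_mul]
  by_cases hN : ∃ n : ℕ, N + (p * t : ℕ) = 24 * n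
  · obtain ⟨n, hn⟩ := hN
    push_cast at hn
    have hfirst : p * N + t = 24 * (p * n - e * t) := by
      linear_combination p * hn - t * he'
    have hdvd : (p : ℤ) ∣ N ↔ p ∣ n := by
      have hcop : IsCoprime (p : ℤ) 24 := ⟨p, -e, by linear_combination he'⟩
      have h1 : N = 24 * n - p * t := by linear_combination hn
      rw [h1, dvd_sub_left (dvd_mul_right _ _), ← Int.natCast_dvd_natCast]
      exact ⟨fun h ↦ hcop.dvd_of_dvd_mul_left h, fun h ↦ h.mul_left _⟩
    refine Eq.trans (congrArg₂ _ ?_ ?_) ((hc n).trans (Finset.sum_congr rfl fun j hj ↦ ?_))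
    · split_ifs with h
      · refine multipartitionShift_of_eq ?_
        rw [hfirst]
        push_cast [h]
        rfl
      · refine multipartitionShift_of_forall_ne fun m hm ↦ h ?_
        rw [hfirst] at hm
        zify
        linarith
    · by_cases h : p ∣ n
      · rw [if_pos h, if_pos (hdvd.mpr h)]
        refine multipartitionShift_of_eq ?_
        obtain ⟨m, rfl⟩ := h
        rw [Nat.mul_div_cancel_left _ (by omega)]
        push_cast at hn
        rw [show N = p * (24 * m - t) by linear_combination hn,
          Int.mul_ediv_cancel_left _ hp0.ne']
        ring
      · rw [if_neg h, if_neg (mt hdvd.mp h)]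
    · have hj' := hle j hj
      split_ifs with h
      · rw [multipartitionShift_of_eq (n := n - j)]
        push_cast [h, hj']
        linear_combination hn
      · rw [multipartitionShift_of_forall_ne, mul_zero]
        intro m hm
        push_cast [hj'] at hm
        omega
  · push Not at hN
    rw [multipartitionShift_of_forall_ne, zero_add, Finset.sum_eq_zero]
    · split_ifs with h
      · obtain ⟨M, rfl⟩ := h
        rw [Int.mul_ediv_cancel_left _ hp0.ne']
        refine multipartitionShift_of_forall_ne fun m hm ↦ hN (p * m) ?_
        push_cast
        linear_combination p * hm
      · rfl
    · intro j hj
      have hj' := hle j hj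
      rw [multipartitionShift_of_forall_ne, mul_zero]
      intro m hm
      refine hN (m + j) ?_
      push_cast [hj'] at hm ⊢
      linear_combination hm
    · intro m hm
      have h1 : N + (p * t : ℕ) = 24 * (p * m - e * N) := by
        push_cast
        linear_combination p * hm - N * he'
      have h2 : 0 ≤ N + (p * t : ℕ) := by
        have h3 : 0 ≤ p * N + t := by omega
        push_cast
        by_contra! hlt
        have h4 : N + p * t ≤ -1 := by omega
        have h5 : (t : ℤ) ≤ p * (p * t) := by nlinarith
        nlinarith
      refine hN (p * m - e * N : ℤ).toNat ?_
      omega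

/-- The span of the shifted multipartition series with index at least `t`, less than `A`
and congruent to `A` modulo `24`. -/
def lowerSpan (t A : ℕ) : Submodule (ZMod 2) (ℤ → ZMod 2) :=
  Submodule.span (ZMod 2) (multipartitionShift '' {s | t ≤ s ∧ ∃ j, s + 24 * (j + 1) = A})

lemma multipartitionShift_mem_lowerSpan {t s A : ℕ} (h : t ≤ s) (j : ℕ)
    (hj : s + 24 * (j + 1) = A) : multipartitionShift s ∈ lowerSpan t A :=
  Submodule.subset_span ⟨s, ⟨h, j, hj⟩, rfl⟩

lemma lowerSpan_le {t A B : ℕ} (j : ℕ) (h : A + 24 * j = B) : lowerSpan t A ≤ lowerSpan t B := by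
  refine Submodule.span_mono (Set.image_mono ?_)
  rintro s ⟨hs, i, hi⟩
  exact ⟨hs, i + j, by omega⟩

lemma exists_eq_sum_of_mem_lowerSpan {t A : ℕ} {f : ℤ → ZMod 2} (hf : f ∈ lowerSpan t A) :
    ∃ c : ℕ → ZMod 2, c 0 = 0 ∧
      f = ∑ j ∈ Finset.range ((A - t) / 24 + 1), c j • multipartitionShift (A - 24 * j) := by
  refine Submodule.span_induction (p := fun f _ ↦ ∃ c : ℕ → ZMod 2, c 0 = 0 ∧
      f = ∑ j ∈ Finset.range ((A - t) / 24 + 1), c j • multipartitionShift (A - 24 * j))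
    ?_ ?_ ?_ ?_ hf
  · rintro _ ⟨s, ⟨hs, j, hj⟩, rfl⟩
    refine ⟨Pi.single (j + 1) 1, by simp, ?_⟩
    rw [Finset.sum_eq_single (j + 1)]
    · rw [Pi.single_eq_same, one_smul, show A - 24 * (j + 1) = s by omega]
    · intro i _ hi
      rw [Pi.single_eq_of_ne hi, zero_smul]
    · intro h
      exact absurd (Finset.mem_range.mpr (by omega)) h
  · exact ⟨0, rfl, by simp⟩
  · rintro f g _ _ ⟨c, hc, rfl⟩ ⟨d, hd, rfl⟩
    exact ⟨c + d, by simp [hc, hd], by simp [add_smul, Finset.sum_add_distrib]⟩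
  · rintro r f _ ⟨c, hc, rfl⟩
    exact ⟨r • c, by simp [hc], by simp [Finset.smul_sum, mul_smul]⟩

lemma exists_eq_sum_of_sub_mem_lowerSpan {t A : ℕ} {f : ℤ → ZMod 2}
    (hf : f - multipartitionShift A ∈ lowerSpan t A) :
    ∃ c : ℕ → ZMod 2, c 0 = 1 ∧
      f = ∑ j ∈ Finset.range ((A - t) / 24 + 1), c j • multipartitionShift (A - 24 * j) := by
  obtain ⟨c, hc0, hc⟩ := exists_eq_sum_of_mem_lowerSpan hf
  refine ⟨c + Pi.single 0 1, by simp [hc0], ?_⟩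
  simp_rw [Pi.add_apply, add_smul, Finset.sum_add_distrib, ← hc]
  rw [Finset.sum_eq_single 0 (by intro j _ hj; rw [Pi.single_eq_of_ne hj, zero_smul]) (by simp)]
  simp

lemma dilate_add_inflate_sub_mem {p t s : ℕ} [Fact p.Prime] (hp5 : 5 ≤ p) (ht : 0 < t)
    (hs : t ≤ s) :
    (dilate p + inflate p) (multipartitionShift s) - multipartitionShift (p * s) ∈
      lowerSpan t (p * s) := by
  obtain ⟨c, hc0, hc⟩ := exists_dilate_add_inflate_eq (p := p) hp5 (ht.trans_le hs)
  rw [LinearMap.add_apply, hc, Finset.sum_range_succ', hc0, one_smul, mul_zero, Nat.sub_zero,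
    add_sub_cancel_right]
  refine Submodule.sum_mem _ fun j hj ↦ Submodule.smul_mem _ _ ?_
  have h : s * (p - 1) + s = p * s := by
    obtain ⟨m, rfl⟩ := Nat.exists_eq_add_of_le' (show 1 ≤ p by omega)
    rw [Nat.add_sub_cancel]
    ring
  have := Finset.mem_range.mp hj
  exact multipartitionShift_mem_lowerSpan (by omega) j (by omega)

lemma map_mem_lowerSpan {p t A : ℕ} [Fact p.Prime] (hp5 : 5 ≤ p) (ht : 0 < t)
    {f : ℤ → ZMod 2} (hf : f ∈ lowerSpan t A) :
    (dilate p + inflate p) f ∈ lowerSpan t (p * A) := by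
  suffices h : lowerSpan t A ≤ (lowerSpan t (p * A)).comap (dilate p + inflate p) from h hf
  refine Submodule.span_le.mpr ?_
  rintro _ ⟨s, ⟨hs, j, rfl⟩, rfl⟩
  change _ ∈ lowerSpan t _
  rw [← sub_add_cancel ((dilate p + inflate p) (multipartitionShift s))
    (multipartitionShift (p * s))]
  refine Submodule.add_mem _
    (lowerSpan_le (p * (j + 1)) (by ring) (dilate_add_inflate_sub_mem hp5 ht hs)) ?_
  obtain ⟨m, rfl⟩ := Nat.exists_eq_add_of_le' (show 1 ≤ p by omega)
  exact multipartitionShift_mem_lowerSpan (by nlinarith) (m * (j + 1) + j) (by ring)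

lemma exists_dilate_pow_eq {p t : ℕ} [Fact p.Prime] (hp5 : 5 ≤ p) (ht : 0 < t) (β : ℕ) :
    ∃ f g : ℤ → ZMod 2,
      f - multipartitionShift (p ^ (β + 1) * t) ∈ lowerSpan t (p ^ (β + 1) * t) ∧
      g - multipartitionShift (p ^ β * t) ∈ lowerSpan t (p ^ β * t) ∧
      (dilate p ^ (β + 1)) (multipartitionShift t) = f + inflate p g := by
  have hneg : ∀ x : ℤ → ZMod 2, x + x = 0 := CharTwo.add_self_eq_zero
  induction β with
  | zero =>
    refine ⟨(dilate p + inflate p) (multipartitionShift t), multipartitionShift t, ?_, ?_, ?_⟩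
    · simpa using dilate_add_inflate_sub_mem hp5 ht le_rfl
    · simp
    · rw [zero_add, pow_one, LinearMap.add_apply, add_assoc, hneg, add_zero]
  | succ β ih =>
    obtain ⟨f, g, hf, hg, hfg⟩ := ih
    refine ⟨(dilate p + inflate p) f + g, f, ?_, hf, ?_⟩
    · obtain ⟨e, he⟩ := exists_mul_self_eq_of_prime (Fact.out : p.Prime) hp5
      have hA : p ^ (β + 1 + 1) * t = p * (p ^ (β + 1) * t) := by ring
      have hB : p ^ β * t + 24 * (e * (p ^ β * t)) = p ^ (β + 1 + 1) * t := by
        linear_combination (p ^ β * t) * he.symm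
      have hBpos : t ≤ p ^ β * t := Nat.le_mul_of_pos_left _ (by positivity)
      obtain ⟨i, hi⟩ : ∃ i, e * (p ^ β * t) = i + 1 :=
        ⟨e * (p ^ β * t) - 1, by
          have : 0 < e := by nlinarith
          have : 0 < e * (p ^ β * t) := by positivity
          omega⟩
      have h1 := map_mem_lowerSpan hp5 ht hf
      have h2 := dilate_add_inflate_sub_mem (p := p) hp5 ht
        (Nat.le_mul_of_pos_left t (show 0 < p ^ (β + 1) by positivity))
      rw [← hA] at h1 h2
      have h3 := lowerSpan_le _ hB hg
      have h4 : multipartitionShift (p ^ β * t) ∈ lowerSpan t (p ^ (β + 1 + 1) * t) :=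
        multipartitionShift_mem_lowerSpan hBpos i (by rw [← hi, hB])
      have h := Submodule.add_mem _ (Submodule.add_mem _ h1 h2) (Submodule.add_mem _ h3 h4)
      rw [map_sub] at h
      convert h using 1
      abel
    · rw [pow_succ', Module.End.mul_apply, hfg, map_add,
        dilate_inflate (Fact.out : p.Prime).ne_zero, LinearMap.add_apply]
      have := hneg (inflate p f)
      linear_combination -this

lemma sum_range_eq_sum_range_of_forall {M : Type*} [AddCommMonoid M] {m n : ℕ} (h : m ≤ n)
    {f g : ℕ → M} (hfg : ∀ j < m, f j = g j) (hg : ∀ j, m ≤ j → g j = 0) :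
    ∑ j ∈ Finset.range m, f j = ∑ j ∈ Finset.range n, g j := by
  rw [Finset.sum_congr rfl fun j hj ↦ hfg j (Finset.mem_range.mp hj)]
  refine Finset.sum_subset (Finset.range_mono h) fun j _ hj ↦ hg j ?_
  simpa using hj

lemma dvd_mul_sub_of_residue {a t b : ℕ} (ha1 : a ≠ 1)
    (hbmod : if a = 1 then b = 0
      else if t % 6 = 3 then (8 * b) % a = (t / 3) % a
      else (24 * b) % a = t % a) : (a : ℤ) ∣ 24 * b - t := by
  rw [if_neg ha1] at hbmod
  split_ifs at hbmod with h6
  · have h : (t / 3 : ℕ) ≡ 8 * b [MOD a] := hbmod.symm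
    have h1 : (a : ℤ) ∣ ((8 * b : ℕ) : ℤ) - (t / 3 : ℕ) := Nat.modEq_iff_dvd.mp h
    have h2 : (24 * b - t : ℤ) = 3 * (((8 * b : ℕ) : ℤ) - (t / 3 : ℕ)) := by
      push_cast
      omega
    rw [h2]
    exact h1.mul_left _
  · have h : t ≡ 24 * b [MOD a] := hbmod.symm
    exact_mod_cast Nat.modEq_iff_dvd.mp h

lemma mul_ceil_eq {p α t a k b : ℕ} (hp : p.Prime) (hp5 : 5 ≤ p) (ha : a = p ^ α)
    (hk : k = (t * (a ^ 2 - 1) + (24 * a - 1)) / (24 * a)) (hb : b < a)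
    (hdvd : (a : ℤ) ∣ 24 * b - t) : 24 * a * k + t = 24 * b + t * a ^ 2 := by
  have hapos : 0 < a := by omega
  obtain ⟨e, he⟩ : ∃ e : ℕ, a ^ 2 = 24 * e + 1 := by
    obtain ⟨e, he⟩ := exists_mul_self_eq_of_prime hp hp5
    have h : a ^ 2 ≡ 1 [MOD 24] := by
      rw [ha, ← pow_mul, mul_comm, pow_mul, sq, he]
      have : 24 * e + 1 ≡ 1 [MOD 24] := by simp [Nat.ModEq]
      simpa using this.pow α
    have h1 : a ^ 2 % 24 = 1 := h
    exact ⟨a ^ 2 / 24, by omega⟩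
  have hsub : a ^ 2 - 1 = 24 * e := by omega
  obtain ⟨m, hm⟩ : ∃ m : ℕ, b + t * e = a * m := by
    have he' : (a ^ 2 : ℤ) = 24 * e + 1 := by exact_mod_cast he
    have h1 : (a : ℤ) ∣ 24 * (b + t * e) := by
      obtain ⟨c, hc⟩ := hdvd
      exact ⟨c + t * a, by linear_combination hc - t * he'⟩
    have h2 : IsCoprime (a : ℤ) 24 := ⟨a, -e, by linear_combination he'⟩
    have h3 : (a : ℤ) ∣ (b + t * e : ℕ) := by
      push_cast
      exact h2.dvd_of_dvd_mul_left h1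
    exact Int.natCast_dvd_natCast.mp h3
  have hkm : k = m := by
    rw [hk, hsub]
    refine Nat.div_eq_of_lt_le ?_ ?_
    · have : 24 * (b + t * e) = 24 * (a * m) := by rw [hm]
      have : t * (24 * e) = 24 * (t * e) := by ring
      have : m * (24 * a) = 24 * (a * m) := by ring
      omega
    · have : 24 * (b + t * e) = 24 * (a * m) := by rw [hm]
      have : t * (24 * e) = 24 * (t * e) := by ring
      have : (m + 1) * (24 * a) = 24 * (a * m) + 24 * a := by ring
      omega
  rw [hkm, he]
  linear_combination 24 * hm.symm

/-- Chen's theorem: for `a = p^α` with `p ≥ 5` prime and `t` odd, with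
`k = ⌈t(a² − 1)/(24a)⌉` and `b` the residue mod `a` of `(t/3)·8⁻¹` if
`t ≡ 3 (mod 6)` and of `t·24⁻¹` otherwise, there are `ε_{d,j} ∈ {0,1}`
(for `d ∣ a`, `0 ≤ j ≤ ⌊k/d⌋`) with `ε_{1,0} = 1` and `ε_{d,j} = 0`
whenever `at/d − 24j < 0`, such that
`q^k ∑ p_t(an+b) qⁿ ≡ ∑_{d∣a} ∑_{j=0}^{⌊k/d⌋} ε_{d,j} q^{dj} / ∏(1−q^{di})^{at/d−24j} (mod 2)`;
the coefficient of `qⁿ⁺ᵏ` on the right is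
`∑_{d∣a} ∑_{j ≤ ⌊k/d⌋, d ∣ n+k−dj} ε_{d,j} p_{at/d−24j}((n+k−dj)/d)`. -/
theorem chen_identity_prime_power
    (p α t : ℕ) (hp : p.Prime) (hp5 : 5 ≤ p) (hα : 1 ≤ α)
    (ht : Odd t) (ht0 : 0 < t)
    (a : ℕ) (ha : a = p ^ α)
    (k : ℕ) (hk : k = (t * (a ^ 2 - 1) + (24 * a - 1)) / (24 * a))
    (b : ℕ) (hb : b < a)
    (hbmod : if a = 1 then b = 0
      else if t % 6 = 3 then (8 * b) % a = (t / 3) % a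
      else (24 * b) % a = t % a) :
    ∃ ε : ℕ → ℕ → ZMod 2,
      ε 1 0 = 1 ∧
      (∀ d ∈ a.divisors, ∀ j ≤ k / d, a * t / d < 24 * j → ε d j = 0) ∧
      ∀ n : ℕ,
        (multipartition t (a * n + b) : ZMod 2) =
          ∑ d ∈ a.divisors, ∑ j ∈ Finset.range (k / d + 1),
            if d ∣ n + k - d * j then
              ε d j * (multipartition (a * t / d - 24 * j) ((n + k - d * j) / d) : ZMod 2)
            else 0 := by
  have : Fact p.Prime := ⟨hp⟩
  obtain ⟨β, rfl⟩ := Nat.exists_eq_add_of_le' hα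
  set a' := p ^ β with ha'
  have haa' : a = p * a' := by rw [ha, pow_succ']
  have ha'pos : 0 < a' := by positivity
  have hppos : 0 < p := by omega
  have ha1 : a ≠ 1 := by nlinarith
  have hK := mul_ceil_eq hp hp5 ha hk hb (dvd_mul_sub_of_residue ha1 hbmod)
  obtain ⟨f, g, hf, hg, hfg⟩ := exists_dilate_pow_eq (p := p) hp5 ht0 β
  rw [← ha] at hf
  rw [← ha'] at hg
  obtain ⟨c, hc0, hc⟩ := exists_eq_sum_of_sub_mem_lowerSpan hf
  obtain ⟨c', -, hc'⟩ := exists_eq_sum_of_sub_mem_lowerSpan hg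
  have hta : t ≤ a * t := Nat.le_mul_of_pos_left _ (by omega)
  have hta' : t ≤ a' * t := Nat.le_mul_of_pos_left _ ha'pos
  have hkle : a * t ≤ 24 * k + t := by
    by_contra! h
    have h1 : a * (24 * k + t + 1) ≤ a * (a * t) := Nat.mul_le_mul_left _ h
    nlinarith
  have hkle' : p * (a' * t) ≤ 24 * k + p * t := by
    rw [← mul_assoc, ← haa']
    nlinarith
  have hdiv : a * t / p = a' * t := by
    rw [haa', mul_assoc, Nat.mul_div_cancel_left _ hppos]
  refine ⟨fun d j ↦ if d = 1 then (if 24 * j ≤ a * t - t then c j else 0) else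
    if d = p then (if 24 * j ≤ a' * t - t then c' j else 0) else 0, by simp [hc0], ?_, ?_⟩
  · intro d _ j _ hj
    dsimp only
    split_ifs with h1 h2 h3 h4
    · subst h1
      rw [Nat.div_one] at hj
      omega
    · rfl
    · subst h3
      rw [hdiv] at hj
      omega
    · rfl
    · rfl
  intro n
  have hN := congrFun hfg (24 * (n + k) - a * t)
  rw [dilate_pow_apply, multipartitionShift_of_eq (n := a * n + b)] at hN
  swap
  · have hK' : (24 * a * k + t : ℤ) = 24 * b + t * a ^ 2 := by exact_mod_cast hK
    rw [← Nat.cast_pow, ← ha]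
    push_cast
    linear_combination hK'
  rw [hN, Pi.add_apply]
  have hsub : ({1, p} : Finset ℕ) ⊆ a.divisors := by
    intro d hd
    rw [Nat.mem_divisors]
    refine ⟨?_, by omega⟩
    rcases Finset.mem_insert.mp hd with rfl | hd
    · exact one_dvd _
    · rw [Finset.mem_singleton.mp hd, haa']
      exact dvd_mul_right _ _
  rw [← Finset.sum_subset hsub, Finset.sum_pair (by omega)]
  swap
  · intro d _ hd
    simp only [Finset.mem_insert, Finset.mem_singleton, not_or] at hd
    simp [hd.1, hd.2]
  congr 1
  · rw [hc, Finset.sum_apply]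
    refine sum_range_eq_sum_range_of_forall (by omega) (fun j hj ↦ ?_) fun j hj ↦ ?_
    · dsimp only
      rw [if_pos (one_dvd _), if_pos rfl, if_pos (by omega), Pi.smul_apply, smul_eq_mul,
        Nat.div_one, Nat.div_one, one_mul]
      congr 1
      refine multipartitionShift_of_eq ?_
      have h1 : 24 * j ≤ a * t := by omega
      have h2 : j ≤ n + k := by omega
      push_cast [h1, h2]
      ring
    · dsimp only
      rw [if_pos (one_dvd _), if_pos rfl, if_neg (by omega), zero_mul]
  · have hp1 : p ≠ 1 := by omega
    have hcop : IsCoprime (p : ℤ) 24 := by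
      obtain ⟨e, he⟩ := exists_mul_self_eq_of_prime hp hp5
      have he' : (p * p : ℤ) = 24 * e + 1 := by exact_mod_cast he
      exact ⟨p, -e, by linear_combination he'⟩
    have haZ : (a : ℤ) = p * a' := by exact_mod_cast haa'
    have hiff : (p : ℤ) ∣ 24 * (n + k) - a * t ↔ p ∣ n + k := by
      rw [haZ, mul_assoc, dvd_sub_left (dvd_mul_right _ _), ← Int.natCast_dvd_natCast]
      push_cast
      exact ⟨fun h ↦ hcop.dvd_of_dvd_mul_left h, fun h ↦ h.mul_left _⟩
    have hiff' : ∀ j ∈ Finset.range (k / p + 1), (p ∣ n + k - p * j ↔ p ∣ n + k) := by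
      intro j hj
      have h1 : j * p ≤ k := (Nat.le_div_iff_mul_le hppos).mp (by
        have := Finset.mem_range.mp hj
        omega)
      rw [mul_comm] at h1
      exact Nat.dvd_sub_iff_left (by omega) (dvd_mul_right _ _)
    rw [inflate_apply]
    by_cases hd : p ∣ n + k
    · rw [if_pos (hiff.mpr hd), Finset.sum_congr rfl fun j hj ↦ if_pos ((hiff' j hj).mpr hd),
        hc', Finset.sum_apply]
      obtain ⟨m, hm⟩ := hd
      have hm' : (n + k : ℤ) = p * m := by exact_mod_cast hm
      have hbd : ∀ j, 24 * j ≤ a' * t - t → j ≤ k / p := by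
        intro j hj
        rw [Nat.le_div_iff_mul_le hppos]
        have h1 : p * (24 * j + t) ≤ p * (a' * t) := Nat.mul_le_mul_left _ (by omega)
        nlinarith
      refine sum_range_eq_sum_range_of_forall ?_ (fun j hj ↦ ?_) fun j hj ↦ ?_
      · have := hbd ((a' * t - t) / 24) (by omega)
        omega
      · dsimp only
        rw [if_neg hp1, if_pos rfl, if_pos (by omega), Pi.smul_apply, smul_eq_mul, hdiv, hm,
          ← Nat.mul_sub, Nat.mul_div_cancel_left _ hppos]
        congr 1
        refine multipartitionShift_of_eq ?_
        have h1 : 24 * j ≤ a' * t := by omega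
        have h2 : j ≤ m := by
          have h3 := hbd j (by omega)
          rw [Nat.le_div_iff_mul_le hppos] at h3
          nlinarith
        rw [hm', haZ, show (24 * (p * m) - p * a' * t : ℤ) = p * (24 * m - a' * t) by ring,
          Int.mul_ediv_cancel_left _ (by omega)]
        push_cast [h1, h2]
        ring
      · dsimp only
        rw [if_neg hp1, if_pos rfl, if_neg (by omega), zero_mul]
    · rw [if_neg (mt hiff.mp hd), Finset.sum_eq_zero]
      intro j hj
      rw [if_neg (mt (hiff' j hj).mp hd)]
end

section
/- Suppose the odd density δ_1 of the partition function p(n) exists and the odd density δ_5 of the 5-multipartition function exists with δ_5 > 0. Then δ_1 > 0. -/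
open Filter

/-- Number of `n ≤ x` with `multipartition t n` odd. -/
def oddCount (t x : ℕ) : ℕ :=
  ((Finset.range (x + 1)).filter (fun n => Odd (multipartition t n))).card

/-- The odd density of the `t`-multipartition function exists and equals `δ`. -/
def hasOddDensity (t : ℕ) (δ : ℝ) : Prop :=
  Tendsto (fun x : ℕ => (oddCount t x : ℝ) / x) atTop (nhds δ)

namespace MultipartitionParity

open Finset PowerSeries

section Theta

variable {R : Type*} [CommRing R] {ι κ : Type*}

/-- The formal theta series `∑ i, X ^ e i` of an exponent function with finite fibres. -/
noncomputable def thetaSeries (R : Type*) [CommRing R] {ι : Type*} (e : ι → ℕ) : R⟦X⟧ :=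
  PowerSeries.mk fun n => (Nat.card {i // e i = n} : R)

theorem coeff_thetaSeries (e : ι → ℕ) (n : ℕ) :
    coeff n (thetaSeries R e) = (Nat.card {i // e i = n} : R) := coeff_mk _ _

theorem thetaSeries_congr {e : ι → ℕ} {e' : κ → ℕ} (g : ι ≃ κ) (h : ∀ i, e' (g i) = e i) :
    thetaSeries R e = thetaSeries R e' := by
  ext n
  simp only [coeff_thetaSeries]
  rw [Nat.card_congr (g.subtypeEquiv (q := fun j => e' j = n) fun i => by rw [h])]

theorem thetaSeries_sumElim {e : ι → ℕ} {e' : κ → ℕ} (he : ∀ n, Finite {i // e i = n})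
    (he' : ∀ n, Finite {i // e' i = n}) :
    thetaSeries R (Sum.elim e e') = thetaSeries R e + thetaSeries R e' := by
  ext n
  have : Finite {i // Sum.elim e e' (Sum.inl i) = n} := he n
  have : Finite {i // Sum.elim e e' (Sum.inr i) = n} := he' n
  simp only [coeff_thetaSeries, map_add]
  rw [Nat.card_congr (Equiv.subtypeSum), Nat.card_sum]
  simp

/-- A fibre of `e i + e' j` decomposes into products of fibres of `e` and `e'`. -/
def fibreAddEquiv (e : ι → ℕ) (e' : κ → ℕ) (n : ℕ) : {p : ι × κ // e p.1 + e' p.2 = n} ≃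
    Σ a : antidiagonal n, {i // e i = a.1.1} × {j // e' j = a.1.2} where
  toFun p := ⟨⟨(e p.1.1, e' p.1.2), by simpa using p.2⟩, ⟨p.1.1, rfl⟩, ⟨p.1.2, rfl⟩⟩
  invFun q := ⟨(q.2.1.1, q.2.2.1), by
    rw [q.2.1.2, q.2.2.2]; exact mem_antidiagonal.mp q.1.2⟩
  left_inv p := rfl
  right_inv := by
    rintro ⟨⟨⟨a, b⟩, h⟩, ⟨i, hi⟩, ⟨j, hj⟩⟩
    change e i = a at hi
    change e' j = b at hj
    subst hi hj
    rfl

theorem thetaSeries_mul {e : ι → ℕ} {e' : κ → ℕ} (he : ∀ n, Finite {i // e i = n})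
    (he' : ∀ n, Finite {i // e' i = n}) :
    thetaSeries R e * thetaSeries R e' = thetaSeries R fun p : ι × κ => e p.1 + e' p.2 := by
  ext n
  simp only [coeff_thetaSeries, coeff_mul]
  rw [Nat.card_congr (fibreAddEquiv e e' n), Nat.card_sigma]
  simp only [Nat.card_prod, Nat.cast_sum, Nat.cast_mul]
  exact (sum_coe_sort (antidiagonal n) fun a : ℕ × ℕ =>
    (Nat.card {i // e i = a.1} : R) * (Nat.card {j // e' j = a.2} : R)).symm

theorem finite_fibre_add {e : ι → ℕ} {e' : κ → ℕ} (he : ∀ n, Finite {i // e i = n})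
    (he' : ∀ n, Finite {i // e' i = n}) (n : ℕ) :
    Finite {p : ι × κ // e p.1 + e' p.2 = n} :=
  Finite.of_equiv _ (fibreAddEquiv e e' n).symm

theorem expand_thetaSeries {a : ℕ} (ha : a ≠ 0) (e : ι → ℕ) :
    expand a ha (thetaSeries R e) = thetaSeries R fun i => a * e i := by
  ext n
  rw [coeff_expand, coeff_thetaSeries, coeff_thetaSeries]
  split_ifs with h
  · obtain ⟨m, rfl⟩ := h
    rw [Nat.mul_div_cancel_left _ (Nat.pos_of_ne_zero ha),
      Nat.card_congr (Equiv.subtypeEquivRight fun i => (mul_right_inj' ha).symm)]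
  · have : IsEmpty {i // a * e i = n} := ⟨fun i => h ⟨_, i.2.symm⟩⟩
    rw [Nat.card_of_isEmpty, Nat.cast_zero]

theorem X_mul_thetaSeries (e : ι → ℕ) :
    X * thetaSeries R e = thetaSeries R fun i => e i + 1 := by
  ext n
  rcases n with _ | n
  · simp [coeff_thetaSeries]
  · simp [coeff_thetaSeries, coeff_succ_X_mul]

/-- An exponent function `j ↦ (a * j * (j - 1) + 2 * b * j) / 2` with `0 < b < a`. -/
structure IsThetaExponent (a b : ℕ) (e : ℤ → ℕ) : Prop where
  pos : 0 < b
  lt : b < a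
  two_mul : ∀ j : ℤ, 2 * (e j : ℤ) = a * (j * (j - 1)) + 2 * b * j

theorem IsThetaExponent.natAbs_le {a b : ℕ} {e : ℤ → ℕ} (he : IsThetaExponent a b e) (j : ℤ) :
    j.natAbs ≤ e j := by
  have h := he.two_mul j
  have h1 : (1 : ℤ) ≤ b := by exact_mod_cast he.pos
  have h2 : (b : ℤ) + 1 ≤ a := by exact_mod_cast he.lt
  zify
  rcases le_or_gt 0 j with hj | hj
  · rw [abs_of_nonneg hj]
    have : 0 ≤ j * (j - 1) := by
      rcases hj.eq_or_lt with rfl | hj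
      · simp
      · exact mul_nonneg hj.le (by omega)
    nlinarith [mul_nonneg (by linarith : (0 : ℤ) ≤ a) this,
      mul_nonneg hj (by linarith : (0 : ℤ) ≤ b - 1)]
  · rw [abs_of_neg hj]
    have : 0 ≤ (-j) * (-j - 1) := mul_nonneg (by omega) (by omega)
    nlinarith [mul_nonneg (by linarith : (0 : ℤ) ≤ a) this,
      mul_nonneg (by omega : (0 : ℤ) ≤ -j) (by linarith : (0 : ℤ) ≤ a - b - 1)]

theorem IsThetaExponent.finite_fibre {a b : ℕ} {e : ℤ → ℕ} (he : IsThetaExponent a b e) (n : ℕ) :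
    Finite {j // e j = n} := by
  refine Set.Finite.to_subtype ((Set.finite_Icc (-(n : ℤ)) n).subset ?_)
  rintro j rfl
  have := he.natAbs_le j
  constructor <;> omega

theorem X_pow_dvd_sum_sub_thetaSeries {a b : ℕ} {e : ℤ → ℕ} (he : IsThetaExponent a b e) (n : ℕ) :
    (X : R⟦X⟧) ^ (n + 1) ∣
      ∑ k ∈ range (2 * n + 1), X ^ e ((k : ℤ) - n) - thetaSeries R e := by
  rw [X_pow_dvd_iff]
  intro m hm
  rw [map_sub, map_sum, coeff_thetaSeries, sub_eq_zero]
  simp only [coeff_X_pow]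
  rw [sum_boole]
  congr 1
  rw [← Nat.card_eq_finsetCard]
  refine Nat.card_congr ⟨fun k => ⟨(k.1 : ℤ) - n, ?_⟩, fun j => ⟨(j.1 + n).toNat, ?_⟩, ?_, ?_⟩
  · exact (mem_filter.mp k.2).2.symm
  · have h := he.natAbs_le j.1
    rw [j.2] at h
    rw [mem_filter, mem_range, Int.toNat_of_nonneg (by omega)]
    exact ⟨by omega, by rw [add_sub_cancel_right, j.2]⟩
  · intro k
    simp
  · intro j
    have h := he.natAbs_le j.1
    rw [j.2] at h
    ext
    simp only
    omega

end Theta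

section GaussianBinomial

variable {R : Type*} [CommRing R]

/-- Gaussian binomial coefficients evaluated at an element `q` of a ring. -/
def gaussBinom (q : R) : ℕ → ℕ → R
  | _, 0 => 1
  | 0, _ + 1 => 0
  | n + 1, k + 1 => gaussBinom q n (k + 1) + q ^ (n - k) * gaussBinom q n k

theorem gaussBinom_eq_zero (q : R) {n k : ℕ} (h : n < k) : gaussBinom q n k = 0 := by
  induction n generalizing k with
  | zero => obtain ⟨k, rfl⟩ := Nat.exists_eq_succ_of_ne_zero h.ne'; rfl
  | succ n ih =>
    obtain ⟨k, rfl⟩ := Nat.exists_eq_succ_of_ne_zero (by omega : k ≠ 0)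
    simp [gaussBinom, ih (by omega : n < k + 1), ih (by omega : n < k)]

theorem gaussBinom_mul_prod (q : R) {n k : ℕ} (h : k ≤ n) :
    gaussBinom q n k * (∏ i ∈ range k, (1 - q ^ (i + 1))) *
      (∏ i ∈ range (n - k), (1 - q ^ (i + 1))) = ∏ i ∈ range n, (1 - q ^ (i + 1)) := by
  induction n generalizing k with
  | zero => obtain rfl : k = 0 := by omega
            simp [gaussBinom]
  | succ n ih =>
    rcases k with _ | k
    · simp [gaussBinom]
    · rw [gaussBinom, Nat.add_sub_add_right, prod_range_succ _ n]
      have h2 := ih (by omega : k ≤ n)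
      rcases (by omega : k = n ∨ k + 1 ≤ n) with rfl | hk
      · rw [gaussBinom_eq_zero q (Nat.lt_succ_self k), ← h2, prod_range_succ _ k]
        simp
        ring
      · have h1 := ih hk
        obtain ⟨m, rfl⟩ := Nat.exists_eq_add_of_le hk
        have e1 : k + 1 + m - k = m + 1 := by omega
        have e2 : k + 1 + m - (k + 1) = m := by omega
        rw [e1] at h2 ⊢
        rw [e2] at h1
        have h3 : q ^ (k + 1 + m + 1) = q ^ (m + 1) * q ^ (k + 1) := by ring
        rw [prod_range_succ _ m] at h2 ⊢
        rw [prod_range_succ _ k] at h1 ⊢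
        rw [h3]
        linear_combination (1 - q ^ (m + 1)) * h1 + q ^ (m + 1) * (1 - q ^ (k + 1)) * h2

theorem prod_add_mul_pow (A q : R) (n : ℕ) :
    ∏ i ∈ range n, (A + q ^ i) =
      ∑ k ∈ range (n + 1), gaussBinom q n k * q ^ (k.choose 2) * A ^ (n - k) := by
  induction n with
  | zero => simp [gaussBinom]
  | succ n ih =>
    have hA : (∑ k ∈ range (n + 1), gaussBinom q n k * q ^ (k.choose 2) * A ^ (n - k)) * A =
        ∑ k ∈ range (n + 1), gaussBinom q n (k + 1) * q ^ ((k + 1).choose 2) * A ^ (n - k) +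
          A ^ (n + 1) := by
      rw [sum_range_succ', sum_range_succ _ n, gaussBinom_eq_zero q (Nat.lt_add_one n), add_mul,
        sum_mul]
      have h2 : ∀ k ∈ range n,
          gaussBinom q n (k + 1) * q ^ (k + 1).choose 2 * A ^ (n - (k + 1)) * A =
            gaussBinom q n (k + 1) * q ^ (k + 1).choose 2 * A ^ (n - k) := by
        intro k hk
        obtain ⟨m, rfl⟩ := Nat.exists_eq_add_of_lt (mem_range.mp hk)
        have e1 : k + m + 1 - (k + 1) = m := by omega
        have e2 : k + m + 1 - k = m + 1 := by omega
        rw [e1, e2]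
        ring
      rw [sum_congr rfl h2]
      simp [gaussBinom, pow_succ]
    have h1 : ∀ k ∈ range (n + 1),
        gaussBinom q (n + 1) (k + 1) * q ^ ((k + 1).choose 2) * A ^ (n + 1 - (k + 1)) =
        gaussBinom q n (k + 1) * q ^ ((k + 1).choose 2) * A ^ (n - k) +
        gaussBinom q n k * q ^ (k.choose 2) * A ^ (n - k) * q ^ n := by
      intro k hk
      obtain ⟨m, rfl⟩ := Nat.exists_eq_add_of_le (mem_range_succ_iff.mp hk)
      have e1 : k + m - k = m := by omega
      rw [gaussBinom, Nat.add_sub_add_right, e1, Nat.choose_succ_succ' k 1, Nat.choose_one_right]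
      ring
    rw [prod_range_succ, ih, sum_range_succ' _ (n + 1), mul_add, hA, sum_congr rfl h1,
      sum_add_distrib, sum_mul]
    simp [gaussBinom]
    ring

end GaussianBinomial
section TripleProduct

variable {R : Type*} [CommRing R]

theorem X_pow_dvd_prod_sub_prod {m n : ℕ} (h : m ≤ n) : (X : R⟦X⟧) ^ (m + 1) ∣
    ∏ i ∈ range n, (1 - (X : R⟦X⟧) ^ (i + 1)) - ∏ i ∈ range m, (1 - (X : R⟦X⟧) ^ (i + 1)) := by
  induction n, h using Nat.le_induction with
  | base => simp
  | succ n hn ih =>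
    rw [prod_range_succ]
    have h1 : (X : R⟦X⟧) ^ (m + 1) ∣ X ^ (n + 1) := pow_dvd_pow _ (by omega)
    have := ih.sub (h1.mul_left (∏ i ∈ range n, (1 - (X : R⟦X⟧) ^ (i + 1))))
    convert this using 1
    ring

theorem X_pow_dvd_pentagonalSeries_sub_prod (m : ℕ) : (X : R⟦X⟧) ^ (m + 1) ∣
    pentagonalSeries R - ∏ i ∈ range m, (1 - (X : R⟦X⟧) ^ (i + 1)) := by
  rw [X_pow_dvd_iff]
  intro k hk
  obtain ⟨s, hs⟩ := eventually_atTop.mp (coeff_prod_one_sub_X_pow_eventually_eq R k)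
  obtain ⟨N, hN⟩ := s.exists_nat_subset_range
  have h1 := hs (range (max N m)) (hN.trans (range_mono (le_max_left N m)))
  have h2 := X_pow_dvd_iff.mp (X_pow_dvd_prod_sub_prod (R := R) (le_max_right N m)) k hk
  rw [map_sub] at h2 ⊢
  rwa [← h1]

theorem constantCoeff_pentagonalSeries : constantCoeff (pentagonalSeries R) = 1 := by
  have h := X_pow_dvd_iff.mp (X_pow_dvd_pentagonalSeries_sub_prod (R := R) 0) 0 (by simp)
  rw [map_sub, sub_eq_zero] at h
  simpa using h

theorem isUnit_expand_pentagonalSeries {a : ℕ} (ha : a ≠ 0) :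
    IsUnit (expand a ha (pentagonalSeries R)) := by
  rw [isUnit_iff_constantCoeff, constantCoeff_expand, constantCoeff_pentagonalSeries]
  exact isUnit_one

theorem X_pow_dvd_expand_pentagonalSeries_sub_prod {a : ℕ} (ha : a ≠ 0) {l m : ℕ} (h : l ≤ m) :
    (X : R⟦X⟧) ^ (a * (l + 1)) ∣ expand a ha (pentagonalSeries R) -
      ∏ i ∈ range m, (1 - ((X : R⟦X⟧) ^ a) ^ (i + 1)) := by
  have h1 : (X : R⟦X⟧) ^ (l + 1) ∣ pentagonalSeries R - ∏ i ∈ range m, (1 - X ^ (i + 1)) :=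
    (pow_dvd_pow _ (by omega)).trans (X_pow_dvd_pentagonalSeries_sub_prod m)
  have := map_dvd (expand a ha) h1
  simpa [map_prod, ← pow_mul] using this

theorem X_pow_dvd_mul_gaussBinom_sub_one {a : ℕ} (ha : a ≠ 0) {l k n : ℕ} (hk : l ≤ k)
    (hn : l + k ≤ n) : (X : R⟦X⟧) ^ (a * (l + 1)) ∣
      expand a ha (pentagonalSeries R) * gaussBinom (X ^ a) n k - 1 := by
  rw [← (isUnit_expand_pentagonalSeries ha).dvd_mul_left]
  have h1 := X_pow_dvd_expand_pentagonalSeries_sub_prod (R := R) ha hk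
  have h2 := X_pow_dvd_expand_pentagonalSeries_sub_prod (R := R) ha (by omega : l ≤ n - k)
  have h3 := X_pow_dvd_expand_pentagonalSeries_sub_prod (R := R) ha (by omega : l ≤ n)
  rw [← gaussBinom_mul_prod _ (by omega : k ≤ n)] at h3
  set F := expand a ha (pentagonalSeries R)
  set c := gaussBinom ((X : R⟦X⟧) ^ a) n k
  set D := ∏ i ∈ range k, (1 - ((X : R⟦X⟧) ^ a) ^ (i + 1))
  set D' := ∏ i ∈ range (n - k), (1 - ((X : R⟦X⟧) ^ a) ^ (i + 1))
  have := ((h1.mul_left (c * F)).add (h2.mul_left (c * D))).sub h3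
  convert this using 1
  ring

theorem IsThetaExponent.shift {a b : ℕ} {e : ℤ → ℕ} (he : IsThetaExponent a b e) {n k : ℕ}
    (hn : 0 < n) (hk : k ≤ 2 * n) : a * k.choose 2 + (a * n - b) * (2 * n - k) =
      a * n.choose 2 + n * (a * n - b) + e ((k : ℤ) - n) := by
  have h := he.two_mul ((k : ℤ) - n)
  have hlt := he.lt
  have h1 : b ≤ a * n := hlt.le.trans (Nat.le_mul_of_pos_right a hn)
  have h2 : ∀ m : ℕ, 2 * (m.choose 2 : ℤ) = m * (m - 1) := by
    intro m
    have : m.choose 2 * 2 = m * (m - 1) := by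
      rw [Nat.choose_two_right, Nat.div_mul_cancel (Nat.even_mul_pred_self m).two_dvd]
    rcases m with _ | m
    · simp
    · rw [Nat.add_sub_cancel] at this
      push_cast
      have : ((m + 1).choose 2 : ℤ) * 2 = (m + 1) * m := by exact_mod_cast this
      linarith
  zify [h1, hk]
  have := h2 k
  have := h2 n
  refine mul_left_cancel₀ (two_ne_zero' ℤ) ?_
  linear_combination (a : ℤ) * h2 k - a * h2 n - h

/-- A finite form of the Jacobi triple product, modulo a power of `X`. -/
theorem X_pow_dvd_triple_product {a b : ℕ} {e : ℤ → ℕ} (he : IsThetaExponent a b e) (ha : a ≠ 0)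
    {n : ℕ} (hn : 0 < n) : (X : R⟦X⟧) ^ (n + 1) ∣
      expand a ha (pentagonalSeries R) *
        ((∏ i ∈ range n, (1 + (X : R⟦X⟧) ^ (a * i + b))) *
          ∏ i ∈ range n, (1 + (X : R⟦X⟧) ^ (a * i + (a - b)))) - thetaSeries R e := by
  have hlt := he.lt
  have hb : b ≤ a * n := hlt.le.trans (Nat.le_mul_of_pos_right a hn)
  set E := a * n.choose 2 + n * (a * n - b) with hE
  set F := expand a ha (pentagonalSeries R) with hF
  have hprod : (X : R⟦X⟧) ^ E * ((∏ i ∈ range n, (1 + (X : R⟦X⟧) ^ (a * i + b))) *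
      ∏ i ∈ range n, (1 + (X : R⟦X⟧) ^ (a * i + (a - b)))) =
      ∏ i ∈ range (2 * n), ((X : R⟦X⟧) ^ (a * n - b) + (X ^ a) ^ i) := by
    have h1 : ∏ i ∈ range n, ((X : R⟦X⟧) ^ (a * n - b) + (X ^ a) ^ i) =
        X ^ (a * n.choose 2) * ∏ i ∈ range n, (1 + (X : R⟦X⟧) ^ (a * i + (a - b))) := by
      rw [← prod_range_reflect (fun i => 1 + (X : R⟦X⟧) ^ (a * i + (a - b))), pow_mul,
        Nat.choose_two_right, ← sum_range_id, ← prod_pow_eq_pow_sum, ← prod_mul_distrib]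
      refine prod_congr rfl fun i hi => ?_
      obtain ⟨m, rfl⟩ := Nat.exists_eq_add_of_lt (mem_range.mp hi)
      have e1 : i + m + 1 - 1 - i = m := by omega
      have e2 : a * (i + m + 1) - b = a * i + (a * m + (a - b)) := by
        rw [show a * (i + m + 1) = a * i + a * m + a by ring]
        omega
      rw [e1, e2]
      ring
    have h2 : ∏ i ∈ range n, ((X : R⟦X⟧) ^ (a * n - b) + (X ^ a) ^ (n + i)) =
        X ^ (n * (a * n - b)) * ∏ i ∈ range n, (1 + (X : R⟦X⟧) ^ (a * i + b)) := by
      have hc : (X : R⟦X⟧) ^ (n * (a * n - b)) = ∏ i ∈ range n, X ^ (a * n - b) := by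
        rw [prod_const, card_range, ← pow_mul, mul_comm]
      rw [hc, ← prod_mul_distrib]
      refine prod_congr rfl fun i hi => ?_
      have e2 : a * (n + i) = (a * n - b) + (a * i + b) := by
        rw [mul_add]
        omega
      rw [← pow_mul, e2]
      ring
    rw [two_mul, prod_range_add, h1, h2, hE]
    ring
  have hsum : ∏ i ∈ range (2 * n), ((X : R⟦X⟧) ^ (a * n - b) + (X ^ a) ^ i) =
      X ^ E * ∑ k ∈ range (2 * n + 1), gaussBinom ((X : R⟦X⟧) ^ a) (2 * n) k *
        X ^ e ((k : ℤ) - n) := by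
    rw [prod_add_mul_pow, mul_sum]
    refine sum_congr rfl fun k hk => ?_
    have := he.shift hn (mem_range_succ_iff.mp hk)
    rw [← pow_mul, ← pow_mul, mul_assoc, ← pow_add, this, pow_add]
    ring
  have hP := X_pow_mul_cancel (hprod.trans hsum)
  rw [hP]
  have := X_pow_dvd_sum_sub_thetaSeries (R := R) he n
  rw [← sub_add_sub_cancel _ (∑ k ∈ range (2 * n + 1), (X : R⟦X⟧) ^ e ((k : ℤ) - n))]
  refine dvd_add ?_ this
  rw [mul_sum, ← sum_sub_distrib]
  refine dvd_sum fun k hk => ?_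
  have hk := mem_range_succ_iff.mp hk
  have h1 := X_pow_dvd_mul_gaussBinom_sub_one (R := R) ha (l := min k (2 * n - k)) (k := k)
    (n := 2 * n) (min_le_left _ _) (by omega)
  have h2 := mul_dvd_mul h1 (dvd_refl ((X : R⟦X⟧) ^ e ((k : ℤ) - n)))
  rw [← pow_add] at h2
  have h3 := he.natAbs_le ((k : ℤ) - n)
  have h4 : min k (2 * n - k) + 1 ≤ a * (min k (2 * n - k) + 1) :=
    Nat.le_mul_of_pos_left _ (Nat.pos_of_ne_zero ha)
  refine (pow_dvd_pow _ (by omega)).trans (h2.trans (dvd_of_eq ?_))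
  ring

end TripleProduct
section ModTwo

theorem eq_of_forall_X_pow_dvd {R : Type*} [CommRing R] {f g : R⟦X⟧}
    (h : ∀ n : ℕ, 0 < n → (X : R⟦X⟧) ^ (n + 1) ∣ f - g) : f = g := by
  ext n
  have := X_pow_dvd_iff.mp (h (n + 1) n.succ_pos) n (by omega)
  rwa [map_sub, sub_eq_zero] at this

theorem two_eq_zero_modTwo : (2 : (ZMod 2)⟦X⟧) = 0 := by
  have : (2 : ZMod 2) = 0 := rfl
  rw [← map_ofNat (C (R := ZMod 2)), this, map_zero]

theorem one_sub_modTwo (f : (ZMod 2)⟦X⟧) : 1 - f = 1 + f := by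
  linear_combination -f * two_eq_zero_modTwo

theorem expand_two (f : (ZMod 2)⟦X⟧) : expand 2 two_ne_zero f = f ^ 2 := by
  have h := MvPowerSeries.map_frobenius_expand (R := ZMod 2) 2 two_ne_zero (f := f)
  have hf : frobenius (ZMod 2) 2 = RingHom.id (ZMod 2) := ZMod.frobenius_zmod 2
  rw [hf, MvPowerSeries.map_id] at h
  exact h

theorem expand_four (f : (ZMod 2)⟦X⟧) : expand 4 four_ne_zero f = f ^ 4 := by
  have := expand_mul (R := ZMod 2) 2 two_ne_zero 2 two_ne_zero f
  rw [expand_two, expand_two] at this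
  rw [show f ^ 4 = (f ^ 2) ^ 2 by ring, ← this]

/-- The Euler product `∏ (1 - X ^ (n + 1))` modulo two. -/
noncomputable abbrev eulerSeries : (ZMod 2)⟦X⟧ := pentagonalSeries (ZMod 2)

/-- The Euler product in the variable `X ^ 5` modulo two. -/
noncomputable abbrev eulerSeriesFive : (ZMod 2)⟦X⟧ := expand 5 (by decide) eulerSeries

theorem eulerSeries_ne_zero : eulerSeries ≠ 0 := by
  intro h
  have := constantCoeff_pentagonalSeries (R := ZMod 2)
  simp [h] at this

theorem eulerSeriesFive_ne_zero : eulerSeriesFive ≠ 0 :=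
  (isUnit_expand_pentagonalSeries _).ne_zero

/-- The triangular numbers, indexed by the integers as `j * (2 * j - 1)`. -/
def triangularExponent (j : ℤ) : ℕ := (j * (2 * j - 1)).toNat

theorem two_mul_toNat_ediv_two {k : ℤ} (h0 : 0 ≤ k) (h : 2 ∣ k) : 2 * ((k / 2).toNat : ℤ) = k := by
  omega

theorem mul_mul_sub_nonneg {a b : ℤ} (hb : 0 ≤ b) (hab : b ≤ a) (j : ℤ) :
    0 ≤ j * (a * j - b) := by
  rcases le_or_gt j 0 with hj | hj
  · exact mul_nonneg_of_nonpos_of_nonpos hj (by nlinarith)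
  · exact mul_nonneg hj.le (by nlinarith)

theorem natCast_triangularExponent (j : ℤ) : (triangularExponent j : ℤ) = j * (2 * j - 1) :=
  Int.toNat_of_nonneg (mul_mul_sub_nonneg (by norm_num) (by norm_num) j)

theorem isThetaExponent_triangularExponent : IsThetaExponent 4 1 triangularExponent where
  pos := by decide
  lt := by decide
  two_mul j := by
    rw [natCast_triangularExponent]
    push_cast
    ring

/-- The exponent function `j * (5 * j - 3) / 2`. -/
def thetaExponentOne (j : ℤ) : ℕ := (j * (5 * j - 3) / 2).toNat

/-- The exponent function `j * (5 * j - 1) / 2`. -/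
def thetaExponentTwo (j : ℤ) : ℕ := (j * (5 * j - 1) / 2).toNat

theorem two_mul_thetaExponentOne (j : ℤ) : 2 * (thetaExponentOne j : ℤ) = j * (5 * j - 3) := by
  refine two_mul_toNat_ediv_two (mul_mul_sub_nonneg (by norm_num) (by norm_num) j) ?_
  refine (even_iff_two_dvd).mp ?_
  grind

theorem two_mul_thetaExponentTwo (j : ℤ) : 2 * (thetaExponentTwo j : ℤ) = j * (5 * j - 1) := by
  refine two_mul_toNat_ediv_two (mul_mul_sub_nonneg (by norm_num) (by norm_num) j) ?_
  refine (even_iff_two_dvd).mp ?_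
  grind

theorem isThetaExponent_thetaExponentOne : IsThetaExponent 5 1 thetaExponentOne where
  pos := by decide
  lt := by decide
  two_mul j := by
    rw [two_mul_thetaExponentOne]
    push_cast
    ring

theorem isThetaExponent_thetaExponentTwo : IsThetaExponent 5 2 thetaExponentTwo where
  pos := by decide
  lt := by decide
  two_mul j := by
    rw [two_mul_thetaExponentTwo]
    push_cast
    ring

theorem thetaSeries_triangularExponent :
    thetaSeries (ZMod 2) triangularExponent = eulerSeries ^ 3 := by
  have key : expand 2 two_ne_zero eulerSeries * thetaSeries (ZMod 2) triangularExponent =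
      expand 4 four_ne_zero eulerSeries * eulerSeries := by
    refine eq_of_forall_X_pow_dvd fun n hn => ?_
    have h1 := X_pow_dvd_triple_product (R := ZMod 2) isThetaExponent_triangularExponent
      four_ne_zero hn
    have h2 := (pow_dvd_pow (X : (ZMod 2)⟦X⟧) (by omega : n + 1 ≤ 2 * (n + 1))).trans
      (X_pow_dvd_expand_pentagonalSeries_sub_prod (R := ZMod 2) two_ne_zero
        (by omega : n ≤ 2 * n))
    have h3 := (pow_dvd_pow (X : (ZMod 2)⟦X⟧) (by omega : n + 1 ≤ 4 * n + 1)).trans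
      (X_pow_dvd_pentagonalSeries_sub_prod (R := ZMod 2) (4 * n))
    have hprod : ((∏ i ∈ range n, (1 + (X : (ZMod 2)⟦X⟧) ^ (4 * i + 1))) *
          ∏ i ∈ range n, (1 + (X : (ZMod 2)⟦X⟧) ^ (4 * i + (4 - 1)))) *
        ∏ i ∈ range (2 * n), (1 - ((X : (ZMod 2)⟦X⟧) ^ 2) ^ (i + 1)) =
        ∏ i ∈ range (4 * n), (1 - (X : (ZMod 2)⟦X⟧) ^ (i + 1)) := by
      simp only [one_sub_modTwo, ← pow_mul]
      clear h1 h2 h3 hn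
      induction n with
      | zero => simp
      | succ n ih =>
        simp only [mul_add_one 2 n, mul_add_one 4 n, prod_range_succ]
        rw [← ih]
        ring
    rw [← hprod] at h3
    have := (((h1.mul_left (expand 2 two_ne_zero eulerSeries)).neg_right).add
      ((h2.mul_left ((∏ i ∈ range n, (1 + (X : (ZMod 2)⟦X⟧) ^ (4 * i + 1))) *
          ∏ i ∈ range n, (1 + (X : (ZMod 2)⟦X⟧) ^ (4 * i + (4 - 1))))).sub h3 |>.mul_left
        (expand 4 four_ne_zero eulerSeries)))
    convert this using 1
    ring
  rw [expand_two, expand_four] at key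
  refine mul_left_cancel₀ (pow_ne_zero 2 eulerSeries_ne_zero) ?_
  rw [key]
  ring

theorem thetaSeries_mul_thetaSeries_five :
    thetaSeries (ZMod 2) thetaExponentOne * thetaSeries (ZMod 2) thetaExponentTwo =
      eulerSeries * eulerSeriesFive := by
  refine mul_left_cancel₀ eulerSeriesFive_ne_zero (eq_of_forall_X_pow_dvd fun n hn => ?_)
  have h1 := X_pow_dvd_triple_product (R := ZMod 2) isThetaExponent_thetaExponentOne
    (by decide) hn
  have h2 := X_pow_dvd_triple_product (R := ZMod 2) isThetaExponent_thetaExponentTwo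
    (by decide) hn
  have h3 := (pow_dvd_pow (X : (ZMod 2)⟦X⟧) (by omega : n + 1 ≤ 5 * (n + 1))).trans
    (X_pow_dvd_expand_pentagonalSeries_sub_prod (R := ZMod 2) (by decide : 5 ≠ 0) le_rfl)
  have h4 := (pow_dvd_pow (X : (ZMod 2)⟦X⟧) (by omega : n + 1 ≤ 5 * n + 1)).trans
    (X_pow_dvd_pentagonalSeries_sub_prod (R := ZMod 2) (5 * n))
  have hprod : ((∏ i ∈ range n, (1 + (X : (ZMod 2)⟦X⟧) ^ (5 * i + 1))) *
        ∏ i ∈ range n, (1 + (X : (ZMod 2)⟦X⟧) ^ (5 * i + (5 - 1)))) *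
      ((∏ i ∈ range n, (1 + (X : (ZMod 2)⟦X⟧) ^ (5 * i + 2))) *
        ∏ i ∈ range n, (1 + (X : (ZMod 2)⟦X⟧) ^ (5 * i + (5 - 2)))) *
      ∏ i ∈ range n, (1 - ((X : (ZMod 2)⟦X⟧) ^ 5) ^ (i + 1)) =
      ∏ i ∈ range (5 * n), (1 - (X : (ZMod 2)⟦X⟧) ^ (i + 1)) := by
    simp only [one_sub_modTwo, ← pow_mul]
    clear h1 h2 h3 h4 hn
    induction n with
    | zero => simp
    | succ n ih =>
      simp only [mul_add_one 5 n, prod_range_succ]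
      rw [← ih]
      ring
  rw [← hprod] at h4
  set P := (∏ i ∈ range n, (1 + (X : (ZMod 2)⟦X⟧) ^ (5 * i + 1))) *
        ∏ i ∈ range n, (1 + (X : (ZMod 2)⟦X⟧) ^ (5 * i + (5 - 1)))
  set P' := (∏ i ∈ range n, (1 + (X : (ZMod 2)⟦X⟧) ^ (5 * i + 2))) *
        ∏ i ∈ range n, (1 + (X : (ZMod 2)⟦X⟧) ^ (5 * i + (5 - 2)))
  have := ((h3.mul_left (P * P')).sub h4).mul_left (eulerSeriesFive ^ 2)
  have := this.sub (((h1.mul_left (thetaSeries (ZMod 2) thetaExponentTwo)).add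
    (h2.mul_left (eulerSeriesFive * P))).mul_left eulerSeriesFive)
  convert this using 1
  ring

end ModTwo

section Dissection

/-- The map realising the dissection of the double triangular sum modulo five: with
`U + V * I = (2 * r + 4 * s - 1) + (4 * r - 2 * s - 1) * I`, the pair `(r, s)` is sent to the
Gaussian integer associated to `U + V * I` with both coordinates congruent to `3` modulo `4`. -/
def dissectionMap : (ℤ × ℤ) ⊕ (ℤ × ℤ) → ℤ × ℤ
  | .inl (r, s) =>
    if r % 2 = 0 then
      if s % 2 = 0 then ((2 * r + 4 * s) / 4, (4 * r - 2 * s) / 4)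
      else ((2 - 4 * r + 2 * s) / 4, (2 * r + 4 * s) / 4)
    else
      if s % 2 = 0 then ((4 * r - 2 * s) / 4, (2 - 2 * r - 4 * s) / 4)
      else ((2 - 2 * r - 4 * s) / 4, (2 - 4 * r + 2 * s) / 4)
  | .inr (m, n) => (2 * n - m, 1 - 2 * m - n)

theorem dissectionMap_injective : Function.Injective dissectionMap := by
  rintro (⟨r, s⟩ | ⟨m, n⟩) (⟨r', s'⟩ | ⟨m', n'⟩) h <;>
    simp only [dissectionMap] at h <;> (try split_ifs at h) <;>
    simp only [Prod.mk.injEq, Sum.inl.injEq, Sum.inr.injEq, reduceCtorEq] at h ⊢ <;> omega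

theorem dissectionMap_surjective : Function.Surjective dissectionMap := by
  rintro ⟨m, n⟩
  have h : (m + 2 * n) % 5 = 0 ∨ (m + 2 * n) % 5 = 1 ∨ (m + 2 * n) % 5 = 2 ∨
      (m + 2 * n) % 5 = 3 ∨ (m + 2 * n) % 5 = 4 := by omega
  rcases h with h | h | h | h | h
  · refine ⟨.inl ((4 * m + 8 * n) / 10, (8 * m - 4 * n) / 10), ?_⟩
    simp only [dissectionMap]
    split_ifs <;> simp only [Prod.mk.injEq] <;> omega
  · refine ⟨.inl ((8 * m - 4 * n + 2) / 10, (4 - 8 * n - 4 * m) / 10), ?_⟩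
    simp only [dissectionMap]
    split_ifs <;> simp only [Prod.mk.injEq] <;> omega
  · refine ⟨.inr ((2 - m - 2 * n) / 5, (2 * m - n + 1) / 5), ?_⟩
    simp only [dissectionMap, Prod.mk.injEq]
    omega
  · refine ⟨.inl ((4 - 8 * m + 4 * n) / 10, (4 * m + 8 * n - 2) / 10), ?_⟩
    simp only [dissectionMap]
    split_ifs <;> simp only [Prod.mk.injEq] <;> omega
  · refine ⟨.inl ((6 - 4 * m - 8 * n) / 10, (2 - 8 * m + 4 * n) / 10), ?_⟩
    simp only [dissectionMap]
    split_ifs <;> simp only [Prod.mk.injEq] <;> omega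

/-- The dissection map as an equivalence. -/
noncomputable def dissectionEquiv : (ℤ × ℤ) ⊕ (ℤ × ℤ) ≃ ℤ × ℤ :=
  Equiv.ofBijective dissectionMap ⟨dissectionMap_injective, dissectionMap_surjective⟩

theorem triangularExponent_dissectionMap (p : (ℤ × ℤ) ⊕ (ℤ × ℤ)) :
    triangularExponent (dissectionMap p).1 + triangularExponent (dissectionMap p).2 =
      Sum.elim (fun q : ℤ × ℤ => thetaExponentOne q.1 + thetaExponentTwo q.2)
        (fun q => 5 * (triangularExponent q.1 + triangularExponent q.2) + 1) p := by
  zify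
  rcases p with ⟨r, s⟩ | ⟨m, n⟩
  · have h1 := two_mul_thetaExponentOne r
    have h2 := two_mul_thetaExponentTwo s
    simp only [dissectionMap, Sum.elim_inl, Nat.cast_add]
    refine mul_left_cancel₀ (two_ne_zero (α := ℤ)) ?_
    rw [mul_add 2 (thetaExponentOne r : ℤ), h1, h2]
    simp only [natCast_triangularExponent]
    split_ifs with hr hs hs
    · obtain ⟨a, rfl⟩ : ∃ a, r = 2 * a := ⟨r / 2, by omega⟩
      obtain ⟨b, rfl⟩ : ∃ b, s = 2 * b := ⟨s / 2, by omega⟩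
      rw [show (2 * (2 * a) + 4 * (2 * b)) / 4 = a + 2 * b by omega,
        show (4 * (2 * a) - 2 * (2 * b)) / 4 = 2 * a - b by omega]
      ring
    · obtain ⟨a, rfl⟩ : ∃ a, r = 2 * a := ⟨r / 2, by omega⟩
      obtain ⟨b, rfl⟩ : ∃ b, s = 2 * b + 1 := ⟨s / 2, by omega⟩
      rw [show (2 - 4 * (2 * a) + 2 * (2 * b + 1)) / 4 = 1 - 2 * a + b by omega,
        show (2 * (2 * a) + 4 * (2 * b + 1)) / 4 = a + 2 * b + 1 by omega]
      ring
    · obtain ⟨a, rfl⟩ : ∃ a, r = 2 * a + 1 := ⟨r / 2, by omega⟩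
      obtain ⟨b, rfl⟩ : ∃ b, s = 2 * b := ⟨s / 2, by omega⟩
      rw [show (4 * (2 * a + 1) - 2 * (2 * b)) / 4 = 2 * a + 1 - b by omega,
        show (2 - 2 * (2 * a + 1) - 4 * (2 * b)) / 4 = -a - 2 * b by omega]
      ring
    · obtain ⟨a, rfl⟩ : ∃ a, r = 2 * a + 1 := ⟨r / 2, by omega⟩
      obtain ⟨b, rfl⟩ : ∃ b, s = 2 * b + 1 := ⟨s / 2, by omega⟩
      rw [show (2 - 2 * (2 * a + 1) - 4 * (2 * b + 1)) / 4 = -a - 2 * b - 1 by omega,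
        show (2 - 4 * (2 * a + 1) + 2 * (2 * b + 1)) / 4 = b - 2 * a by omega]
      ring
  · simp only [dissectionMap, Sum.elim_inr, natCast_triangularExponent]
    push_cast
    simp only [natCast_triangularExponent]
    ring

theorem eulerSeries_dissection :
    eulerSeries * eulerSeriesFive + X * eulerSeriesFive ^ 6 = eulerSeries ^ 6 := by
  have ht := isThetaExponent_triangularExponent.finite_fibre
  have h1 := isThetaExponent_thetaExponentOne.finite_fibre
  have h2 := isThetaExponent_thetaExponentTwo.finite_fibre
  have hX : X * eulerSeriesFive ^ 6 = thetaSeries (ZMod 2) fun q : ℤ × ℤ =>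
      5 * (triangularExponent q.1 + triangularExponent q.2) + 1 := by
    rw [← X_mul_thetaSeries, ← expand_thetaSeries (by decide), ← thetaSeries_mul ht ht,
      thetaSeries_triangularExponent, map_mul, map_pow]
    ring
  have hF : eulerSeries ^ 6 = thetaSeries (ZMod 2) fun q : ℤ × ℤ =>
      triangularExponent q.1 + triangularExponent q.2 := by
    rw [← thetaSeries_mul ht ht, thetaSeries_triangularExponent]
    ring
  rw [hX, hF, ← thetaSeries_mul_thetaSeries_five, thetaSeries_mul h1 h2,
    ← thetaSeries_sumElim (finite_fibre_add h1 h2)]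
  · exact thetaSeries_congr dissectionEquiv triangularExponent_dissectionMap
  · intro n
    have := finite_fibre_add ht ht (n / 5)
    refine Finite.of_injective (β := {q : ℤ × ℤ // triangularExponent q.1 +
      triangularExponent q.2 = n / 5}) (fun q => ⟨q.1, by have := q.2; omega⟩) fun q q' h => ?_
    simpa [Subtype.ext_iff] using h

end Dissection

section PartitionSeries

/-- The generating function of the number of partitions modulo two. -/
noncomputable def partitionSeries : (ZMod 2)⟦X⟧ :=
  PowerSeries.mk fun n => (Fintype.card (Nat.Partition n) : ZMod 2)

open PowerSeries.WithPiTopology in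
theorem partitionSeries_mul_eulerSeries : partitionSeries * eulerSeries = 1 := by
  let _ : TopologicalSpace (ZMod 2) := ⊥
  have _ : DiscreteTopology (ZMod 2) := ⟨rfl⟩
  have h1 : HasProd (fun i => ∑' j : ℕ, (X : (ZMod 2)⟦X⟧) ^ ((i + 1) * j)) partitionSeries := by
    simpa [Nat.Partition.restricted, partitionSeries] using
      Nat.Partition.hasProd_powerSeriesMk_card_restricted (ZMod 2) fun _ => True
  have h2 := h1.mul (hasProd_one_sub_X_pow (ZMod 2))
  refine h2.unique ?_
  convert! hasProd_one (α := (ZMod 2)⟦X⟧) (β := ℕ) using 2 with i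
  simp only [pow_mul]
  exact tsum_pow_mul_one_sub_of_constantCoeff_eq_zero (by simp)

theorem multipartition_zero (n : ℕ) : multipartition 0 n = if n = 0 then 1 else 0 := by
  rcases n with _ | n <;> simp [multipartition]

theorem multipartition_succ (t n : ℕ) : multipartition (t + 1) n =
    ∑ a ∈ antidiagonal n, Fintype.card (Nat.Partition a.1) * multipartition t a.2 := by
  simp only [multipartition, mul_sum]
  rw [sum_sigma']
  refine sum_bij' (fun v _ => ⟨(v 0, ∑ i, v (Fin.succ i)), Fin.tail v⟩)
    (fun q _ => Fin.cons q.1.1 q.2) ?_ ?_ ?_ ?_ ?_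
  · intro v hv
    rw [Finset.Nat.mem_antidiagonalTuple, Fin.sum_univ_succ] at hv
    simp [Finset.Nat.mem_antidiagonalTuple, hv, Fin.tail_def]
  · rintro ⟨⟨a, b⟩, v⟩ h
    simp only [mem_sigma, HasAntidiagonal.mem_antidiagonal, Finset.Nat.mem_antidiagonalTuple] at h
    simp [Finset.Nat.mem_antidiagonalTuple, Fin.sum_univ_succ, h]
  · intro v _
    exact Fin.cons_self_tail v
  · rintro ⟨⟨a, b⟩, v⟩ h
    simp only [mem_sigma, HasAntidiagonal.mem_antidiagonal, Finset.Nat.mem_antidiagonalTuple] at h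
    simp [h]
  · intro v _
    rw [Fin.prod_univ_succ]
    rfl

theorem mk_multipartition (t : ℕ) :
    PowerSeries.mk (fun n => (multipartition t n : ZMod 2)) = partitionSeries ^ t := by
  induction t with
  | zero =>
    ext n
    simp [multipartition_zero, coeff_one]
  | succ t ih =>
    ext n
    rw [pow_succ', ← ih, coeff_mul, coeff_mk, multipartition_succ]
    simp [partitionSeries]

theorem odd_multipartition_iff (t n : ℕ) :
    Odd (multipartition t n) ↔ coeff n (partitionSeries ^ t) = 1 := by
  rw [← mk_multipartition, coeff_mk, ZMod.natCast_eq_one_iff_odd]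

end PartitionSeries

section Extraction

variable {R : Type*} [CommRing R]

/-- The power series extracting the coefficients with index congruent to `4` modulo `5`. -/
noncomputable def extractFive (f : R⟦X⟧) : R⟦X⟧ := PowerSeries.mk fun n => coeff (5 * n + 4) f

theorem coeff_extractFive (f : R⟦X⟧) (n : ℕ) :
    coeff n (extractFive f) = coeff (5 * n + 4) f := coeff_mk _ _

theorem extractFive_add (f g : R⟦X⟧) : extractFive (f + g) = extractFive f + extractFive g := by
  ext n
  simp [coeff_extractFive]

theorem extractFive_mul_expand (f g : R⟦X⟧) :
    extractFive (f * expand 5 (by decide) g) = extractFive f * g := by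
  ext n
  rw [coeff_extractFive, coeff_mul, coeff_mul]
  refine (sum_of_injOn (fun p : ℕ × ℕ => (5 * p.1 + 4, 5 * p.2)) ?_ ?_ ?_ ?_).symm
  · rintro ⟨a, b⟩ _ ⟨c, d⟩ _ h
    simp only [Prod.mk.injEq] at h ⊢
    omega
  · rintro ⟨a, b⟩ h
    simp only [mem_coe, HasAntidiagonal.mem_antidiagonal] at h ⊢
    omega
  · rintro ⟨a, b⟩ h hab
    rw [HasAntidiagonal.mem_antidiagonal] at h
    rw [coeff_expand_of_not_dvd, mul_zero]
    rintro ⟨c, rfl⟩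
    refine hab ⟨((a - 4) / 5, c), ?_, ?_⟩
    · simp only [mem_coe, HasAntidiagonal.mem_antidiagonal] at h ⊢
      omega
    · change a + 5 * c = 5 * n + 4 at h
      exact Prod.ext (by change 5 * ((a - 4) / 5) + 4 = a; omega) rfl
  · rintro ⟨a, b⟩ _
    rw [coeff_extractFive, coeff_expand_mul]

theorem extractFive_X_mul_expand_two (f : R⟦X⟧) :
    extractFive (X * expand 2 two_ne_zero f) = X * expand 2 two_ne_zero (extractFive f) := by
  ext n
  rw [coeff_extractFive, coeff_succ_X_mul, coeff_expand]
  rcases n with _ | n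
  · simp
  · rw [coeff_succ_X_mul, coeff_expand, coeff_extractFive]
    by_cases h : 2 ∣ n
    · rw [if_pos (by omega), if_pos h]
      congr 2
      omega
    · rw [if_neg (by omega), if_neg h]

end Extraction

section MainIdentity

theorem coeff_eulerSeries_congr {m n : ℕ}
    (h : m ∈ Set.range pentagonal ↔ n ∈ Set.range pentagonal) :
    coeff m eulerSeries = coeff n eulerSeries := by
  have h1 (k : ℤ) : ((Int.negOnePow k : ℤˣ) : ZMod 2) = 1 := by
    rcases Int.units_eq_one_or (Int.negOnePow k) with h | h <;> rw [h] <;> rfl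
  by_cases hm : m ∈ Set.range pentagonal
  · obtain ⟨k, rfl⟩ := hm
    obtain ⟨l, rfl⟩ := h.mp ⟨k, rfl⟩
    rw [coeff_pentagonalSeries_pentagonal, coeff_pentagonalSeries_pentagonal]
    simp [h1]
  · rw [coeff_pentagonalSeries_eq_zero _ hm,
      coeff_pentagonalSeries_eq_zero _ (h.not.mp hm)]

theorem exists_of_pentagonal_eq {k : ℤ} {m : ℕ} (h : pentagonal k = 5 * m + 1) :
    ∃ j : ℤ, k = 5 * j + 1 ∧ m = 5 * pentagonal (-j) := by
  have h1 := two_mul_natCast_pentagonal k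
  rw [h] at h1
  push_cast at h1
  have h5 : k % 5 = 1 := by
    have h2 : (k * (3 * k - 1)) % 5 = 2 := by omega
    have h3 : k % 5 = 0 ∨ k % 5 = 1 ∨ k % 5 = 2 ∨ k % 5 = 3 ∨ k % 5 = 4 := by omega
    rcases h3 with h | h | h | h | h <;> simp [Int.mul_emod, Int.sub_emod, h] at h2 ⊢
  obtain ⟨j, rfl⟩ : ∃ j, k = 5 * j + 1 := ⟨k / 5, by omega⟩
  refine ⟨j, rfl, ?_⟩
  have h2 := two_mul_natCast_pentagonal_neg j
  zify
  linarith

theorem coeff_five_mul_add_one_eulerSeries (m : ℕ) :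
    coeff (5 * m + 1) eulerSeries = coeff m eulerSeriesFive := by
  rw [coeff_expand]
  split_ifs with h
  · obtain ⟨l, rfl⟩ := h
    refine coeff_eulerSeries_congr ?_
    rw [Nat.mul_div_cancel_left _ (by decide)]
    constructor
    · rintro ⟨k, hk⟩
      obtain ⟨j, -, hj⟩ := exists_of_pentagonal_eq hk
      exact ⟨-j, by omega⟩
    · rintro ⟨j, rfl⟩
      refine ⟨5 * (-j) + 1, ?_⟩
      have h1 := two_mul_natCast_pentagonal j
      have h2 := two_mul_natCast_pentagonal (5 * (-j) + 1)
      zify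
      linarith
  · refine coeff_pentagonalSeries_eq_zero _ ?_
    rintro ⟨k, hk⟩
    obtain ⟨j, -, rfl⟩ := exists_of_pentagonal_eq hk
    exact h (dvd_mul_right _ _)

theorem extractFive_eulerSeries_pow_four :
    extractFive (eulerSeries ^ 4) = eulerSeriesFive ^ 4 := by
  ext n
  rw [coeff_extractFive, ← expand_four, ← expand_four, coeff_expand, coeff_expand]
  by_cases h : 4 ∣ n
  · obtain ⟨m, rfl⟩ := h
    rw [if_pos (by omega), if_pos (dvd_mul_right _ _), Nat.mul_div_cancel_left _ (by decide),
      ← coeff_five_mul_add_one_eulerSeries]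
    congr 2
    omega
  · rw [if_neg (by omega), if_neg h]

theorem partitionSeries_dissection :
    partitionSeries = eulerSeries ^ 4 * expand 5 (by decide) partitionSeries +
      X * expand 2 two_ne_zero partitionSeries * expand 5 (by decide) (eulerSeries ^ 5) := by
  have h1 := partitionSeries_mul_eulerSeries
  have h5 : expand 5 (by decide) partitionSeries * eulerSeriesFive = 1 := by
    rw [← map_mul, h1, map_one]
  rw [expand_two, map_pow]
  have hA := eulerSeries_dissection
  have h2 := two_eq_zero_modTwo
  set P := partitionSeries
  set Q := expand 5 (by decide) P
  set F := eulerSeries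
  set G := eulerSeriesFive
  have h : P = F ^ 4 * Q - X * P ^ 2 * G ^ 5 := by
    calc P = P * (P * F) * (Q * G) := by rw [h1, h5, mul_one, mul_one]
      _ = P ^ 2 * Q * (F * G + X * G ^ 6) - X * P ^ 2 * G ^ 5 * (Q * G) := by ring
      _ = (P * F) ^ 2 * F ^ 4 * Q - X * P ^ 2 * G ^ 5 := by rw [hA, h5]; ring
      _ = F ^ 4 * Q - X * P ^ 2 * G ^ 5 := by rw [h1, one_pow, one_mul]
  linear_combination h - X * P ^ 2 * G ^ 5 * h2

theorem extractFive_partitionSeries :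
    extractFive partitionSeries = eulerSeriesFive ^ 4 * partitionSeries +
      X * extractFive partitionSeries ^ 2 * eulerSeries ^ 5 := by
  conv_lhs => rw [partitionSeries_dissection]
  rw [extractFive_add, extractFive_mul_expand, extractFive_mul_expand,
    extractFive_X_mul_expand_two, extractFive_eulerSeries_pow_four, expand_two]

/-- The generating function of the `5`-multipartition function modulo two. -/
theorem partitionSeries_pow_five : partitionSeries ^ 5 =
    X * extractFive partitionSeries + expand 5 (by decide) partitionSeries := by
  have h1 := partitionSeries_mul_eulerSeries
  have h5 : expand 5 (by decide) partitionSeries * eulerSeriesFive = 1 := by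
    rw [← map_mul, h1, map_one]
  have hA := eulerSeries_dissection
  have hU := extractFive_partitionSeries
  have h2 := two_eq_zero_modTwo
  have hc : constantCoeff partitionSeries = 1 := by
    simp [partitionSeries]
  have hcD : constantCoeff (X * extractFive partitionSeries + partitionSeries ^ 5 +
      expand 5 (by decide) partitionSeries) = 0 := by
    simp only [map_add, map_mul, constantCoeff_X, zero_mul, map_pow, hc, constantCoeff_expand]
    rfl
  set P := partitionSeries
  set Q := expand 5 (by decide) P
  set F := eulerSeries
  set G := eulerSeriesFive
  set A := extractFive P
  set D := X * A + P ^ 5 + Q with hD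
  have hQ : Q = X * G ^ 4 * P + F ^ 5 * Q ^ 2 := by
    have h : Q = F ^ 5 * Q ^ 2 - X * G ^ 4 * P := by
      calc Q = Q * (Q * G) * (P * F) := by rw [h1, h5, mul_one, mul_one]
        _ = Q ^ 2 * P * (F * G + X * G ^ 6) - X * G ^ 4 * P * (Q * G) ^ 2 := by ring
        _ = F ^ 5 * Q ^ 2 * (P * F) - X * G ^ 4 * P := by rw [hA, h5]; ring
        _ = F ^ 5 * Q ^ 2 - X * G ^ 4 * P := by rw [h1, mul_one]
    linear_combination h - X * G ^ 4 * P * h2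
  have hDD : D * (F ^ 5 * D - 1) = 0 := by
    have hP : F ^ 5 * P ^ 10 = P ^ 5 := by
      rw [show F ^ 5 * P ^ 10 = (P * F) ^ 5 * P ^ 5 by ring, h1, one_pow, one_mul]
    rw [hD]
    linear_combination -X * hU - hQ + hP +
      (F ^ 5 * (X * A * P ^ 5 + X * A * Q + P ^ 5 * Q) - X * G ^ 4 * P) * h2
  rcases mul_eq_zero.mp hDD with h | h
  · linear_combination h - (X * A + Q) * h2
  · have := congrArg constantCoeff h
    simp [hcD] at this

end MainIdentity

theorem odd_multipartition_five {n : ℕ} (h : Odd (multipartition 5 n)) :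
    (1 ≤ n ∧ Odd (multipartition 1 (5 * n - 1))) ∨ (5 ∣ n ∧ Odd (multipartition 1 (n / 5))) := by
  simp only [odd_multipartition_iff, pow_one] at h ⊢
  rw [partitionSeries_pow_five, map_add, coeff_expand] at h
  rcases n with _ | n
  · exact Or.inr (by simpa using h)
  · rw [coeff_succ_X_mul, coeff_extractFive] at h
    by_cases h1 : coeff (5 * n + 4) partitionSeries = 1
    · exact Or.inl ⟨by omega, h1⟩
    · rw [(by decide : ∀ a : ZMod 2, a ≠ 1 → a = 0) _ h1, zero_add] at h
      split_ifs at h with h5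
      · exact Or.inr ⟨h5, h⟩
      · exact absurd h (by decide)

theorem oddCount_five_le (x : ℕ) : oddCount 5 x ≤ 2 * oddCount 1 (5 * x) := by
  have hsub : (range (x + 1)).filter (fun n => Odd (multipartition 5 n)) ⊆
      (range (x + 1)).filter (fun n => 1 ≤ n ∧ Odd (multipartition 1 (5 * n - 1))) ∪
      (range (x + 1)).filter (fun n => 5 ∣ n ∧ Odd (multipartition 1 (n / 5))) := by
    rw [← filter_or]
    exact monotone_filter_right _ fun n _ => odd_multipartition_five
  refine (card_le_card hsub).trans ((card_union_le _ _).trans ?_)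
  rw [two_mul]
  refine add_le_add (card_le_card_of_injOn (fun n => 5 * n - 1) ?_ ?_)
    (card_le_card_of_injOn (fun n => n / 5) ?_ ?_)
  · intro n hn
    simp only [coe_filter, mem_range, Set.mem_ofPred_eq] at hn ⊢
    exact ⟨by omega, hn.2.2⟩
  · intro m hm n hn h
    simp only [coe_filter, mem_range, Set.mem_ofPred_eq] at hm hn h
    omega
  · intro n hn
    simp only [coe_filter, mem_range, Set.mem_ofPred_eq] at hn ⊢
    exact ⟨by omega, hn.2.2⟩
  · intro m hm n hn h
    simp only [coe_filter, mem_range, Set.mem_ofPred_eq] at hm hn h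
    omega

theorem density_five_le {δ₁ δ₅ : ℝ} (h1 : hasOddDensity 1 δ₁) (h5 : hasOddDensity 5 δ₅) :
    δ₅ ≤ 10 * δ₁ := by
  have h : Tendsto (fun x : ℕ => 10 * ((oddCount 1 (5 * x) : ℝ) / (5 * x : ℕ))) atTop
      (nhds (10 * δ₁)) :=
    (h1.comp (tendsto_id.const_mul_atTop' (by decide : 0 < 5))).const_mul 10
  refine le_of_tendsto_of_tendsto' h5 h fun x => ?_
  have hx : (oddCount 5 x : ℝ) ≤ 2 * oddCount 1 (5 * x) := by exact_mod_cast oddCount_five_le x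
  calc (oddCount 5 x : ℝ) / x ≤ 2 * oddCount 1 (5 * x) / x := by gcongr
    _ = 10 * ((oddCount 1 (5 * x) : ℝ) / (5 * x : ℕ)) := by
      push_cast
      rw [mul_div_assoc, ← div_div, div_right_comm]
      ring

end MultipartitionParity

/-- If `δ_1` and `δ_5` exist and `δ_5 > 0`, then `δ_1 > 0`. -/
theorem delta_one_pos_of_delta_five_pos (δ₁ δ₅ : ℝ)
    (h1 : hasOddDensity 1 δ₁) (h5 : hasOddDensity 5 δ₅) (h5pos : 0 < δ₅) :
    0 < δ₁ := by
  linarith [MultipartitionParity.density_five_le h1 h5]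
end
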